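/- arXiv:1205.4603 — 4 statements merged into one kernel-verified Lean document; each statement's English description precedes it below -/
import Mathlib

section
/- Let p ≥ 3 be a prime and let 3 ≤ r < s be integers such that (r-1) ∤ (s-1) and (r-1) ∤ s. Let g be the least positive residue of s-1 modulo r-1, assume 2g ≥ r-1 and that (r-g-2) divides g, and set q_2 = g/(r-g-2). If a ∈ A(s,r) satisfies h_p(a) = min h_p, then δ(a) = ([q], [q+1],…,[q+1] (q_2-fold), [q], [q+1],…,[q+1] (q_2-fold), [q], …, [q+1],…,[q+1] (q_2-fold), [q]); that is, δ(a) consists of r-g-1 singleton entries [q], the first and last entries being [q], separated by exactly r-g-2 blocks each consisting of exactly q_2 consecutive entries [q+1]. -/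
/-- `A(s,r)`: admissible exponent tuples, viewed as functions `ℕ → ℤ` whose relevant
entries are indices `0,…,r-1`: strictly increasing with `a 0 = 0` and `a (r-1) = s-1`. -/
def Admissible (s r : ℕ) (a : ℕ → ℤ) : Prop :=
  a 0 = 0 ∧ a (r - 1) = (s : ℤ) - 1 ∧ ∀ i, i + 1 < r → a i < a (i + 1)

/-- `h_p(x) = Σ_{k<i≤r} p^{-(x_i - x_k)}` (indices `0,…,r-1`). -/
noncomputable def hp (p r : ℕ) (a : ℕ → ℤ) : ℝ :=
  ∑ k ∈ Finset.range r, ∑ i ∈ Finset.range r,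
    if k < i then (p : ℝ) ^ (a k - a i) else 0

/-- `a` is admissible and attains `min h_p` over `A(s,r)`. -/
def IsMinimizer (p s r : ℕ) (a : ℕ → ℤ) : Prop :=
  Admissible s r a ∧ ∀ b : ℕ → ℤ, Admissible s r b → hp p r a ≤ hp p r b

/-- The delta vector of `a`: `δ_j(a) = a_{j+1} - a_j`, relevant for `j = 0,…,r-2`. -/
def dlt (a : ℕ → ℤ) (j : ℕ) : ℤ := a (j + 1) - a j

/-- Bernoulli's inequality for integer exponents, with slope `1 - p⁻¹`. -/
lemma zpow_ge_tangent {p : ℝ} (hp : 1 ≤ p) (e : ℤ) :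
    1 + e * (1 - p⁻¹) ≤ p ^ e := by
  have hp0 : 0 < p := by linarith
  have hinv : p⁻¹ ≤ 1 := inv_le_one_of_one_le₀ hp
  have hinv0 : 0 < p⁻¹ := inv_pos.2 hp0
  obtain ⟨m, rfl | rfl⟩ := e.eq_nat_or_neg
  · have h := one_add_mul_le_pow (a := p - 1) (by linarith) m
    have h1 : 1 - p⁻¹ ≤ p - 1 := by
      have : p * p⁻¹ = 1 := mul_inv_cancel₀ hp0.ne'
      nlinarith [mul_self_nonneg (p - 1)]
    have h2 : (m : ℝ) * (1 - p⁻¹) ≤ m * (p - 1) :=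
      mul_le_mul_of_nonneg_left h1 (Nat.cast_nonneg m)
    rw [add_sub_cancel] at h
    rw [zpow_natCast]
    push_cast
    linarith
  · have h := one_add_mul_le_pow (a := -(1 - p⁻¹)) (by linarith) m
    rw [zpow_neg, zpow_natCast, ← inv_pow]
    have h3 : 1 + -(1 - p⁻¹) = p⁻¹ := by ring
    rw [h3] at h
    push_cast
    linarith

lemma lt_zpow_of_ne_zero {p G : ℝ} (hp : 3 ≤ p) (hG : 0 < G) (hGp : G ≤ p⁻¹)
    {e : ℤ} (he : e ≠ 0) : 1 + e * (1 - p⁻¹) + e * G < p ^ e := by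
  rcases lt_or_gt_of_ne he with h | h
  · have h1 := zpow_ge_tangent (p := p) (by linarith) e
    have h2 : (e : ℝ) < 0 := by exact_mod_cast h
    nlinarith
  · lift e to ℕ using h.le
    have h1 := one_add_mul_le_pow (a := p - 1) (by linarith) e
    have h2 : (0 : ℝ) < e := by exact_mod_cast h
    rw [add_sub_cancel] at h1
    rw [zpow_natCast]
    push_cast
    nlinarith

/-- The slope of the chord of `x ↦ p ^ (-x)` over `[c l, c l + 1]`, up to sign. -/
noncomputable def chordSlope (p : ℝ) (c : ℕ → ℤ) (l : ℕ) : ℝ := p ^ (-c l) * (1 - p⁻¹)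

lemma sum_range_lt_left (w : ℕ → ℝ) {n i : ℕ} (hi : i ≤ n) :
    ∑ k ∈ Finset.range (n + 1), (if k < i then w (i - k) else 0) =
      ∑ l ∈ Finset.range i, w (l + 1) := by
  rw [← Finset.sum_filter]
  have : (Finset.range (n + 1)).filter (fun k => k < i) = Finset.range i := by
    ext k; simp only [Finset.mem_filter, Finset.mem_range]; omega
  rw [this, ← Finset.sum_range_reflect]
  refine Finset.sum_congr rfl fun k hk => ?_
  rw [Finset.mem_range] at hk
  congr 1; omega

lemma sum_range_lt_right (w : ℕ → ℝ) {n k : ℕ} (hk : k ≤ n) :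
    ∑ i ∈ Finset.range (n + 1), (if k < i then w (i - k) else 0) =
      ∑ l ∈ Finset.range (n - k), w (l + 1) := by
  have h : n + 1 = (k + 1) + (n - k) := by omega
  rw [h, Finset.sum_range_add, Finset.sum_eq_zero, zero_add]
  · refine Finset.sum_congr rfl fun l _ => ?_
    rw [if_pos (by omega)]
    congr 1; omega
  · intro i hi
    rw [Finset.mem_range] at hi
    rw [if_neg (by omega)]

lemma sum_weighted_differences (w d : ℕ → ℝ) (n : ℕ) :
    ∑ k ∈ Finset.range (n + 1), ∑ i ∈ Finset.range (n + 1),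
        (if k < i then w (i - k) * (d i - d k) else 0) =
      ∑ j ∈ Finset.range (n + 1), d j *
        (∑ l ∈ Finset.range j, w (l + 1) - ∑ l ∈ Finset.range (n - j), w (l + 1)) := by
  have h : ∀ k i : ℕ, (if k < i then w (i - k) * (d i - d k) else 0) =
      d i * (if k < i then w (i - k) else 0) - d k * (if k < i then w (i - k) else 0) := by
    intro k i; split_ifs <;> ring
  simp_rw [h, Finset.sum_sub_distrib, mul_sub, Finset.sum_sub_distrib]
  congr 1
  · rw [Finset.sum_comm]
    refine Finset.sum_congr rfl fun i hi => ?_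
    rw [Finset.mem_range] at hi
    rw [← Finset.mul_sum, sum_range_lt_left w (by omega)]
  · refine Finset.sum_congr rfl fun k hk => ?_
    rw [Finset.mem_range] at hk
    rw [← Finset.mul_sum, sum_range_lt_right w (by omega)]

lemma sum_interior_le_double_sum {E : ℕ → ℕ → ℝ} {n : ℕ}
    (hE : ∀ k i, i ≤ n → 0 ≤ E k i) :
    ∑ j ∈ Finset.Ioo 0 n, (E 0 j + E j n) ≤
      ∑ k ∈ Finset.range (n + 1), ∑ i ∈ Finset.range (n + 1), E k i := by
  have hE' : ∀ k, ∀ i ∈ Finset.range (n + 1), 0 ≤ E k i := fun k i hi =>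
    hE k i (by rw [Finset.mem_range] at hi; omega)
  calc ∑ j ∈ Finset.Ioo 0 n, (E 0 j + E j n)
      = ∑ j ∈ Finset.Ioo 0 n, E 0 j + ∑ j ∈ Finset.Ioo 0 n, E j n :=
        Finset.sum_add_distrib
    _ ≤ ∑ i ∈ Finset.range (n + 1), E 0 i +
          ∑ k ∈ Finset.Ioo 0 n, ∑ i ∈ Finset.range (n + 1), E k i := by
        refine add_le_add ?_ (Finset.sum_le_sum fun k _ => ?_)
        · refine Finset.sum_le_sum_of_subset_of_nonneg ?_ fun i hi _ => hE' 0 i hi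
          intro j hj
          simp only [Finset.mem_Ioo, Finset.mem_range] at hj ⊢
          omega
        · exact Finset.single_le_sum (f := E k) (hE' k) (by simp)
    _ = ∑ k ∈ insert 0 (Finset.Ioo 0 n), ∑ i ∈ Finset.range (n + 1), E k i := by
        rw [Finset.sum_insert (by simp)]
    _ ≤ _ := by
        refine Finset.sum_le_sum_of_subset_of_nonneg ?_
          fun k _ _ => Finset.sum_nonneg (hE' k)
        intro j hj
        simp only [Finset.mem_insert, Finset.mem_Ioo, Finset.mem_range] at hj ⊢
        omega

/-- Tails of the chord slopes are dominated by a geometric series. -/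
lemma sum_chordSlope_sub_le {p : ℝ} (hp : 1 ≤ p) {c : ℕ → ℤ}
    (hc : ∀ i, c i + 1 ≤ c (i + 1)) (j m : ℕ) :
    ∑ l ∈ Finset.range (j + m), chordSlope p c (l + 1) -
        ∑ l ∈ Finset.range j, chordSlope p c (l + 1) ≤
      p ^ (-c j) * p⁻¹ - p ^ (-c (j + m)) * p⁻¹ := by
  have hp0 : p ≠ 0 := by positivity
  induction m with
  | zero => simp
  | succ m ih =>
    rw [← add_assoc, Finset.sum_range_succ]
    have h : p ^ (-c (j + m + 1)) ≤ p ^ (-c (j + m)) * p⁻¹ := by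
      rw [← zpow_sub_one₀ hp0]
      exact zpow_le_zpow_right₀ hp (by linarith [hc (j + m)])
    have h2 : chordSlope p c (j + m + 1) =
        p ^ (-c (j + m + 1)) - p ^ (-c (j + m + 1)) * p⁻¹ := by
      unfold chordSlope; ring
    linarith

lemma chordSlope_pos {p : ℝ} (hp : 1 < p) (c : ℕ → ℤ) (l : ℕ) : 0 < chordSlope p c l :=
  mul_pos (zpow_pos (by linarith) _) (sub_pos.2 (inv_lt_one_of_one_lt₀ hp))

/-- If every difference `c (t + l) - c t` is `c l` or `c l + 1`, and `c` is symmetric on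
`{0, …, n}`, then `c` is the only minimizer of `hp` among integer tuples with the same ends. -/
lemma eq_of_hp_le {p n : ℕ} (hp3 : 3 ≤ p) {a c : ℕ → ℤ}
    (hc : ∀ i, c i + 1 ≤ c (i + 1))
    (hwin : ∀ t l, c (t + l) - c t = c l ∨ c (t + l) - c t = c l + 1)
    (hsymm : ∀ i ≤ n, c n - c (n - i) = c i)
    (ha0 : a 0 = c 0) (han : a n = c n) (hle : hp p (n + 1) a ≤ hp p (n + 1) c) :
    ∀ j ≤ n, a j = c j := by
  have hP : (3 : ℝ) ≤ p := by exact_mod_cast hp3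
  have hP0 : (p : ℝ) ≠ 0 := by positivity
  have hc0 : c 0 = 0 := by simpa using (hsymm 0 (Nat.zero_le n)).symm
  set w := chordSlope (p : ℝ) c with hw
  set V : ℕ → ℝ := fun j => ∑ l ∈ Finset.range j, w (l + 1)
  set d : ℕ → ℝ := fun i => (a i : ℝ) - c i with hd
  set E : ℕ → ℕ → ℝ := fun k i => if k < i then
    (p : ℝ) ^ (a k - a i) - (p : ℝ) ^ (c k - c i) + w (i - k) * (d i - d k) else 0 with hE
  have hExc : ∀ k i, k < i → E k i = (p : ℝ) ^ (-c (i - k)) *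
      ((p : ℝ) ^ (c (i - k) - (a i - a k)) - 1 -
        ((c (i - k) - (a i - a k) : ℤ) : ℝ) * (1 - (p : ℝ)⁻¹)) := by
    intro k i hki
    obtain ⟨l, rfl⟩ := Nat.exists_eq_add_of_le hki.le
    have h1 : (p : ℝ) ^ (a k - a (k + l)) =
        (p : ℝ) ^ (-c l) * (p : ℝ) ^ (c l - (a (k + l) - a k)) := by
      rw [← zpow_add₀ hP0]; congr 1; ring
    have h2 : (p : ℝ) ^ (c k - c (k + l)) = (p : ℝ) ^ (-c l) *
        (1 - ((c (k + l) - c k - c l : ℤ) : ℝ) * (1 - (p : ℝ)⁻¹)) := by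
      rcases hwin k l with h | h
      · have : c k - c (k + l) = -c l := by linarith
        rw [this, h]; simp
      · have : c k - c (k + l) = -c l - 1 := by linarith
        rw [this, h, zpow_sub_one₀ hP0]; push_cast; ring
    simp only [hE, hd, hw, chordSlope, if_pos hki, add_tsub_cancel_left, h1, h2]
    push_cast
    ring
  have hE0 : ∀ k i, i ≤ n → 0 ≤ E k i := by
    intro k i _
    by_cases hki : k < i
    · rw [hExc k i hki]
      refine mul_nonneg (zpow_nonneg (by positivity) _) ?_
      linarith [zpow_ge_tangent (p := (p : ℝ)) (by linarith) (c (i - k) - (a i - a k))]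
    · simp [hE, hki]
  have hdiff : hp p (n + 1) a - hp p (n + 1) c =
      ∑ k ∈ Finset.range (n + 1), ∑ i ∈ Finset.range (n + 1), E k i -
        ∑ j ∈ Finset.range (n + 1), d j * (V j - V (n - j)) := by
    rw [← sum_weighted_differences w d n]
    unfold hp
    simp only [← Finset.sum_sub_distrib]
    refine Finset.sum_congr rfl fun k _ => Finset.sum_congr rfl fun i _ => ?_
    simp only [hE]
    split_ifs <;> ring
  have hd0 : d 0 = 0 := by simp [hd, ha0]
  have hdn : d n = 0 := by simp [hd, han]
  have hint : ∑ j ∈ Finset.range (n + 1), d j * (V j - V (n - j)) =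
      ∑ j ∈ Finset.Ioo 0 n, d j * (V j - V (n - j)) := by
    symm
    refine Finset.sum_subset ?_ ?_
    · intro j hj
      simp only [Finset.mem_Ioo, Finset.mem_range] at hj ⊢
      omega
    · intro j hj hj'
      simp only [Finset.mem_Ioo, Finset.mem_range] at hj hj'
      obtain rfl | rfl : j = 0 ∨ j = n := by omega
      · rw [hd0, zero_mul]
      · rw [hdn, zero_mul]
  have hpos : ∀ (j : ℕ) (e : ℤ), j < n → e ≠ 0 →
      0 < (p : ℝ) ^ (-c j) * ((p : ℝ) ^ e - 1 - (e : ℝ) * (1 - (p : ℝ)⁻¹)) -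
        e * (V n - V j) := by
    intro j e hj he
    have hpc : 0 < (p : ℝ) ^ (-c j) := zpow_pos (by positivity) _
    have hG0 : 0 < V n - V j := by
      have h : V n = V j + ∑ l ∈ Finset.Ico j n, w (l + 1) :=
        (Finset.sum_range_add_sum_Ico _ hj.le).symm
      rw [h, add_sub_cancel_left]
      exact Finset.sum_pos (fun l _ => chordSlope_pos (by linarith) c _)
        (Finset.nonempty_Ico.2 hj)
    have hG1 : V n - V j ≤ (p : ℝ) ^ (-c j) * (p : ℝ)⁻¹ := by
      have h := sum_chordSlope_sub_le (p := (p : ℝ)) (by linarith) hc j (n - j)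
      rw [Nat.add_sub_cancel' hj.le] at h
      have : 0 ≤ (p : ℝ) ^ (-c n) * (p : ℝ)⁻¹ := by positivity
      exact h.trans (by linarith)
    have h := lt_zpow_of_ne_zero hP (G := (V n - V j) / (p : ℝ) ^ (-c j))
      (div_pos hG0 hpc) (by rwa [div_le_iff₀ hpc, mul_comm]) he
    have h2 : (p : ℝ) ^ (-c j) * ((V n - V j) / (p : ℝ) ^ (-c j)) = V n - V j :=
      mul_div_cancel₀ _ hpc.ne'
    rw [← h2]
    nlinarith [mul_lt_mul_of_pos_left h hpc]
  have hterm : ∀ j ∈ Finset.Ioo 0 n, a j ≠ c j →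
      0 < E 0 j + E j n - d j * (V j - V (n - j)) := by
    intro j hj hne
    rw [Finset.mem_Ioo] at hj
    have h1 := hpos j (c j - a j) hj.2 (by omega)
    have h2 := hpos (n - j) (a j - c j) (by omega) (by omega)
    have e1 : c (j - 0) - (a j - a 0) = c j - a j := by
      rw [ha0, hc0, Nat.sub_zero]; ring
    have e2 : c (n - j) - (a n - a j) = a j - c j := by
      have := hsymm j hj.2.le
      rw [han]; linarith
    rw [hExc 0 j hj.1, hExc j n hj.2, e1, e2, Nat.sub_zero]
    simp only [hd]
    push_cast at h1 h2 ⊢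
    linarith
  by_contra! hcon
  obtain ⟨j, hj, hne⟩ := hcon
  have hj' : j ∈ Finset.Ioo 0 n := by
    rw [Finset.mem_Ioo]
    refine ⟨Nat.pos_of_ne_zero ?_, lt_of_le_of_ne hj ?_⟩
    · rintro rfl; exact hne ha0
    · rintro rfl; exact hne han
  have hsum : 0 < ∑ j ∈ Finset.Ioo 0 n, (E 0 j + E j n - d j * (V j - V (n - j))) := by
    refine Finset.sum_pos' (fun i hi => ?_) ⟨j, hj', hterm j hj' hne⟩
    by_cases h : a i = c i
    · have hdi : d i = 0 := by simp [hd, h]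
      rw [Finset.mem_Ioo] at hi
      rw [hdi, zero_mul, sub_zero]
      exact add_nonneg (hE0 0 i hi.2.le) (hE0 i n le_rfl)
    · exact (hterm i hi h).le
  rw [Finset.sum_sub_distrib] at hsum
  have := sum_interior_le_double_sum hE0
  linarith

/-- The tuple whose delta vector is `Q` at multiples of `u + 1` and `Q + 1` elsewhere. -/
def periodicTuple (Q u i : ℕ) : ℤ := i * ((Q : ℤ) + 1) - ((i + u) / (u + 1) : ℕ)

lemma periodicTuple_succ_sub (Q u i : ℕ) :
    periodicTuple Q u (i + 1) - periodicTuple Q u i =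
      if i % (u + 1) = 0 then (Q : ℤ) else (Q : ℤ) + 1 := by
  have h : (i + 1 + u) / (u + 1) = (i + u) / (u + 1) + if i % (u + 1) = 0 then 1 else 0 := by
    rw [show i + 1 + u = i + u + 1 by ring, Nat.succ_div]
    simp only [add_assoc, Nat.dvd_iff_mod_eq_zero, Nat.add_mod_right]
  unfold periodicTuple
  rw [h]
  split_ifs <;> push_cast <;> ring

lemma periodicTuple_add_sub (Q u t l : ℕ) :
    periodicTuple Q u (t + l) - periodicTuple Q u t = periodicTuple Q u l ∨
      periodicTuple Q u (t + l) - periodicTuple Q u t = periodicTuple Q u l + 1 := by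
  have h1 := Nat.div_add_mod (t + u) (u + 1)
  have h2 := Nat.div_add_mod (l + u) (u + 1)
  have h1' : (t + u) % (u + 1) < u + 1 := Nat.mod_lt _ (Nat.succ_pos u)
  have h2' : (l + u) % (u + 1) < u + 1 := Nat.mod_lt _ (Nat.succ_pos u)
  have h3 := Nat.div_add_mod (t + l + u) (u + 1)
  have h3' : (t + l + u) % (u + 1) < u + 1 := Nat.mod_lt _ (Nat.succ_pos u)
  unfold periodicTuple
  set A := (t + u) / (u + 1)
  set B := (l + u) / (u + 1)
  set C := (t + l + u) / (u + 1)
  generalize (t + u) % (u + 1) = α at h1 h1'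
  generalize (l + u) % (u + 1) = β at h2 h2'
  generalize (t + l + u) % (u + 1) = γ at h3 h3'
  have hC : C ≤ A + B := by
    by_contra! h
    have h' := Nat.mul_le_mul_left (u + 1) (Nat.succ_le_of_lt h)
    rw [Nat.succ_eq_add_one] at h'
    nlinarith
  have hC' : A + B ≤ C + 1 := by
    by_contra! h
    have h' := Nat.mul_le_mul_left (u + 1) (Nat.succ_le_of_lt h)
    rw [Nat.succ_eq_add_one] at h'
    nlinarith
  push_cast
  obtain h | h : (C : ℤ) = A + B ∨ (C : ℤ) = A + B - 1 := by omega
  · left; rw [h]; ring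
  · right; rw [h]; ring

lemma periodicTuple_symm (Q u m : ℕ) {i : ℕ} (hi : i ≤ m * (u + 1) + 1) :
    periodicTuple Q u (m * (u + 1) + 1) - periodicTuple Q u (m * (u + 1) + 1 - i) =
      periodicTuple Q u i := by
  obtain ⟨k, hk⟩ := Nat.exists_eq_add_of_le hi
  have hn : (m * (u + 1) + 1 + u) / (u + 1) = m + 1 := by
    rw [show m * (u + 1) + 1 + u = (m + 1) * (u + 1) by ring]
    exact Nat.mul_div_cancel _ (Nat.succ_pos u)
  rw [show m * (u + 1) + 1 - i = k by omega]
  have h1 := Nat.div_add_mod (i + u) (u + 1)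
  have h2 := Nat.div_add_mod (k + u) (u + 1)
  have h1' : (i + u) % (u + 1) < u + 1 := Nat.mod_lt _ (Nat.succ_pos u)
  have h2' : (k + u) % (u + 1) < u + 1 := Nat.mod_lt _ (Nat.succ_pos u)
  have hki : ((m * (u + 1) + 1 : ℕ) : ℤ) = i + k := by exact_mod_cast hk
  unfold periodicTuple
  rw [hn, hki]
  set A := (i + u) / (u + 1)
  set B := (k + u) / (u + 1)
  generalize (i + u) % (u + 1) = α at h1 h1'
  generalize (k + u) % (u + 1) = β at h2 h2'
  have hle : A + B ≤ m + 1 := by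
    by_contra! h
    have h' := Nat.mul_le_mul_left (u + 1) (Nat.succ_le_of_lt h)
    rw [Nat.succ_eq_add_one] at h'
    nlinarith
  have hge : m + 1 ≤ A + B := by
    by_contra! h
    have h' := Nat.mul_le_mul_left (u + 1) (Nat.succ_le_of_lt h)
    rw [Nat.succ_eq_add_one] at h'
    nlinarith
  have h : ((m + 1 : ℕ) : ℤ) = A + B := by exact_mod_cast le_antisymm hge hle
  rw [h]; ring


/-- Theorem 2.2(i): if `(r-1) ∤ (s-1)`, `(r-1) ∤ s`, `g ≡ s-1 mod (r-1)` is the least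
positive residue, `2g ≥ r-1` and `(r-g-2) ∣ g` with `q₂ = g/(r-g-2)`, then the delta
vector of any minimizer is
`([q], [q+1],…,[q+1] (q₂-fold), [q], …, [q+1],…,[q+1] (q₂-fold), [q])`,
i.e. entry `j` (0-indexed) equals `[q]` iff `j ≡ 0 mod (q₂+1)`, and `[q]+1` otherwise. -/
theorem stmt4 (p s r : ℕ) (hpp : p.Prime) (hp3 : 3 ≤ p) (hr : 3 ≤ r) (hrs : r < s)
    (hndvd1 : ¬ (r - 1) ∣ (s - 1)) (hndvd2 : ¬ (r - 1) ∣ s)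
    (hg : r - 1 ≤ 2 * ((s - 1) % (r - 1)))
    (hq2 : (r - ((s - 1) % (r - 1)) - 2) ∣ ((s - 1) % (r - 1)))
    (a : ℕ → ℤ) (ha : IsMinimizer p s r a) :
    ∀ j < r - 1, dlt a j =
      if j % (((s - 1) % (r - 1)) / (r - ((s - 1) % (r - 1)) - 2) + 1) = 0
      then (((s - 1) / (r - 1) : ℕ) : ℤ)
      else (((s - 1) / (r - 1) : ℕ) : ℤ) + 1 := by
  set g := (s - 1) % (r - 1)
  set Q := (s - 1) / (r - 1)
  obtain ⟨u, hu⟩ := hq2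
  have hdm : (r - 1) * Q + g = s - 1 := Nat.div_add_mod _ _
  have hglt : g < r - 1 := Nat.mod_lt _ (by omega)
  have hgne : g ≠ r - 2 := by
    intro h
    refine hndvd2 ⟨Q + 1, ?_⟩
    rw [mul_add, mul_one]
    omega
  have hm : 0 < r - g - 2 := by omega
  have hdiv : g / (r - g - 2) = u := by
    exact Nat.div_eq_of_eq_mul_right hm hu
  rw [hdiv]
  have hn : r - 1 = (r - g - 2) * (u + 1) + 1 := by
    rw [mul_add, mul_one, ← hu]
    omega
  have hQ : 1 ≤ Q := Nat.div_pos (by omega) (by omega)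
  have hstep : ∀ i, periodicTuple Q u i + 1 ≤ periodicTuple Q u (i + 1) := by
    intro i
    have := periodicTuple_succ_sub Q u i
    split_ifs at this <;> omega
  have hsymm : ∀ i ≤ r - 1,
      periodicTuple Q u (r - 1) - periodicTuple Q u (r - 1 - i) = periodicTuple Q u i := by
    intro i hi
    rw [hn] at hi ⊢
    exact periodicTuple_symm Q u _ hi
  have h0 : periodicTuple Q u 0 = 0 := by simpa using (hsymm 0 (Nat.zero_le _)).symm
  have hend : periodicTuple Q u (r - 1) = (s : ℤ) - 1 := by
    have hceil : (r - 1 + u) / (u + 1) = r - g - 1 := by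
      have : r - 1 + u = (r - g - 1) * (u + 1) := by
        rw [show r - g - 1 = r - g - 2 + 1 by omega, add_mul, one_mul]
        omega
      rw [this, Nat.mul_div_cancel _ (Nat.succ_pos u)]
    have hs : ((r - 1 : ℕ) : ℤ) * Q + g = ((s - 1 : ℕ) : ℤ) := by exact_mod_cast hdm
    unfold periodicTuple
    rw [hceil, mul_add, mul_one]
    omega
  obtain ⟨⟨ha0, han, -⟩, hmin⟩ := ha
  have hle := hmin (periodicTuple Q u) ⟨h0, hend, fun i _ => by have := hstep i; omega⟩
  have heq := eq_of_hp_le (n := r - 1) hp3 hstep (periodicTuple_add_sub Q u) hsymm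
    (ha0.trans h0.symm) (han.trans hend.symm) (by rwa [show r - 1 + 1 = r by omega])
  intro j hj
  rw [dlt, heq j hj.le, heq (j + 1) hj]
  exact periodicTuple_succ_sub Q u j
end

section
/- Let p ≥ 3 be a prime and let 3 ≤ r < s be integers such that (r-1) ∤ (s-1) and (r-1) ∤ s. Let g be the least positive residue of s-1 modulo r-1, assume 2g ≥ r-1 and (r-g-2) ∤ g, and set q_2 = g/(r-g-2). If a ∈ A(s,r) satisfies h_p(a) = min h_p, then d = (d_1,…,d_{r-1}) := δ(a) has the following properties: (1) exactly r-g-1 entries of d equal [q], among them d_1 = d_{r-1} = [q], and no two consecutive entries d_j = d_{j+1} = [q] occur; (2) the remaining g entries of d all equal [q+1] and appear in maximal blocks of consecutive entries of length [q_2] or [q_2]+1, and there are exactly e blocks of length [q_2]+1 and exactly r-g-2-e blocks of length [q_2], where e is the least positive residue of g modulo r-g-2. -/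
/-- `IsMaxRun n d v i l`: within the vector `(d 0, …, d (n-1))`, the entries
`d i, …, d (i+l-1)` form a maximal block of consecutive entries equal to `v`
(of length `l ≥ 1`). -/
def IsMaxRun (n : ℕ) (d : ℕ → ℤ) (v : ℤ) (i l : ℕ) : Prop :=
  0 < l ∧ i + l ≤ n ∧ (∀ k < l, d (i + k) = v) ∧
    (0 < i → d (i - 1) ≠ v) ∧ (i + l < n → d (i + l) ≠ v)

theorem Admissible.add_sub_le {s r : ℕ} {a : ℕ → ℤ} (h : Admissible s r a) {k t : ℕ}
    (hkt : k ≤ t) (ht : t < r) : a k + ((t : ℤ) - k) ≤ a t := by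
  induction t, hkt using Nat.le_induction with
  | base => simp
  | succ t hkt ih =>
    have h1 := ih (by omega)
    have h2 := h.2.2 t ht
    push_cast
    omega

theorem Admissible.mono {s r : ℕ} {a : ℕ → ℤ} (h : Admissible s r a) {k t : ℕ}
    (hkt : k ≤ t) (ht : t < r) : a k ≤ a t := by
  have := h.add_sub_le hkt ht
  omega

theorem two_mul_hp_add {p s r : ℕ} {a : ℕ → ℤ} (h : Admissible s r a) :
    2 * hp p r a + r =
      ∑ k ∈ Finset.range r, ∑ t ∈ Finset.range r, (p : ℝ) ^ (-|a k - a t|) := by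
  have key : ∀ k ∈ Finset.range r, ∀ t ∈ Finset.range r, (p : ℝ) ^ (-|a k - a t|) =
      (if k < t then (p : ℝ) ^ (a k - a t) else 0) +
      (if t < k then (p : ℝ) ^ (a t - a k) else 0) + (if k = t then 1 else 0) := by
    intro k hk t ht
    rw [Finset.mem_range] at hk ht
    rcases lt_trichotomy k t with hlt | rfl | hlt
    · have := h.mono hlt.le ht
      rw [abs_of_nonpos (by omega)]
      simp [hlt, hlt.not_gt, hlt.ne]
    · simp
    · have := h.mono hlt.le hk
      rw [abs_of_nonneg (by omega)]
      simp [hlt, hlt.not_gt, hlt.ne']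
  rw [Finset.sum_congr rfl fun k hk => Finset.sum_congr rfl (key k hk)]
  simp only [Finset.sum_add_distrib]
  rw [Finset.sum_comm (f := fun k t => if t < k then (p : ℝ) ^ (a t - a k) else 0)]
  have h3 : ∑ k ∈ Finset.range r, ∑ t ∈ Finset.range r, (if k = t then (1 : ℝ) else 0) = r := by
    rw [Finset.sum_congr rfl (g := fun _ => (1 : ℝ))]
    · simp
    · intro k hk
      rw [Finset.sum_ite_eq, if_pos hk]
  rw [h3]
  unfold hp
  ring

theorem sum_range_split {M : Type*} [AddCommMonoid M] {i j r : ℕ} (hij : i < j) (hj : j < r)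
    (f : ℕ → M) : ∑ k ∈ Finset.range r, f k =
      ∑ k ∈ Finset.range (i + 1), f k + ∑ k ∈ Finset.Ioo i j, f k + ∑ k ∈ Finset.Ico j r, f k := by
  have h : Finset.Ioo i j = Finset.Ico (i + 1) j := by ext; simp
  rw [h, Finset.range_eq_Ico, Finset.range_eq_Ico,
    Finset.sum_Ico_consecutive _ (by omega) (by omega),
    Finset.sum_Ico_consecutive _ (by omega) (by omega)]

/-- Moving only the entries strictly between `i` and `j`, without changing their mutual
interaction, changes `hp` by the change in the interaction with the other entries. -/
theorem hp_sub_hp {p s r : ℕ} {a b : ℕ → ℤ} (ha : Admissible s r a) (hb : Admissible s r b)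
    {i j : ℕ} (hij : i < j) (hj : j < r) (hab : ∀ t, t ∉ Finset.Ioo i j → b t = a t)
    (hin : ∑ k ∈ Finset.Ioo i j, ∑ t ∈ Finset.Ioo i j, (p : ℝ) ^ (-|b k - b t|) =
      ∑ k ∈ Finset.Ioo i j, ∑ t ∈ Finset.Ioo i j, (p : ℝ) ^ (-|a k - a t|)) :
    hp p r b - hp p r a =
      (∑ k ∈ Finset.range (i + 1), ∑ t ∈ Finset.Ioo i j, (p : ℝ) ^ (a k - b t) -
        ∑ k ∈ Finset.range (i + 1), ∑ t ∈ Finset.Ioo i j, (p : ℝ) ^ (a k - a t)) +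
      (∑ k ∈ Finset.Ico j r, ∑ t ∈ Finset.Ioo i j, (p : ℝ) ^ (b t - a k) -
        ∑ k ∈ Finset.Ico j r, ∑ t ∈ Finset.Ioo i j, (p : ℝ) ^ (a t - a k)) := by
  have expand : ∀ c : ℕ → ℤ, Admissible s r c →
      ∑ k ∈ Finset.range r, ∑ t ∈ Finset.range r, (p : ℝ) ^ (-|c k - c t|) =
      ∑ k ∈ Finset.range (i + 1), ∑ t ∈ Finset.range (i + 1), (p : ℝ) ^ (-|c k - c t|) +
      2 * ∑ k ∈ Finset.range (i + 1), ∑ t ∈ Finset.Ico j r, (p : ℝ) ^ (-|c k - c t|) +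
      ∑ k ∈ Finset.Ico j r, ∑ t ∈ Finset.Ico j r, (p : ℝ) ^ (-|c k - c t|) +
      ∑ k ∈ Finset.Ioo i j, ∑ t ∈ Finset.Ioo i j, (p : ℝ) ^ (-|c k - c t|) +
      2 * ∑ k ∈ Finset.range (i + 1), ∑ t ∈ Finset.Ioo i j, (p : ℝ) ^ (c k - c t) +
      2 * ∑ k ∈ Finset.Ico j r, ∑ t ∈ Finset.Ioo i j, (p : ℝ) ^ (c t - c k) := by
    intro c hc
    have e1 : ∑ k ∈ Finset.range (i + 1), ∑ t ∈ Finset.Ioo i j, (p : ℝ) ^ (c k - c t) =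
        ∑ k ∈ Finset.range (i + 1), ∑ t ∈ Finset.Ioo i j, (p : ℝ) ^ (-|c k - c t|) := by
      refine Finset.sum_congr rfl fun k hk => Finset.sum_congr rfl fun t ht => ?_
      simp only [Finset.mem_range, Finset.mem_Ioo] at hk ht
      have := hc.mono (show k ≤ t by omega) (by omega)
      rw [abs_of_nonpos (by omega), neg_neg]
    have e2 : ∑ k ∈ Finset.Ico j r, ∑ t ∈ Finset.Ioo i j, (p : ℝ) ^ (c t - c k) =
        ∑ k ∈ Finset.Ico j r, ∑ t ∈ Finset.Ioo i j, (p : ℝ) ^ (-|c k - c t|) := by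
      refine Finset.sum_congr rfl fun k hk => Finset.sum_congr rfl fun t ht => ?_
      simp only [Finset.mem_Ico, Finset.mem_Ioo] at hk ht
      have := hc.mono (show t ≤ k by omega) (by omega)
      rw [abs_of_nonneg (by omega), neg_sub]
    have comm : ∀ A B : Finset ℕ, ∑ k ∈ A, ∑ t ∈ B, (p : ℝ) ^ (-|c k - c t|) =
        ∑ k ∈ B, ∑ t ∈ A, (p : ℝ) ^ (-|c k - c t|) := by
      intro A B
      rw [Finset.sum_comm]
      simp only [abs_sub_comm]
    rw [e1, e2, sum_range_split hij hj]
    simp only [sum_range_split hij hj (fun t => (p : ℝ) ^ (-|c _ - c t|)),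
      Finset.sum_add_distrib]
    rw [comm (Finset.Ioo i j) (Finset.range (i + 1)), comm (Finset.Ioo i j) (Finset.Ico j r),
      comm (Finset.Ico j r) (Finset.range (i + 1))]
    ring
  have hl : ∀ k ∈ Finset.range (i + 1), b k = a k := fun k hk =>
    hab k (by simp only [Finset.mem_range, Finset.mem_Ioo] at *; omega)
  have hr : ∀ k ∈ Finset.Ico j r, b k = a k := fun k hk =>
    hab k (by simp only [Finset.mem_Ico, Finset.mem_Ioo] at *; omega)
  have outer : ∀ A B : Finset ℕ, (∀ k ∈ A, b k = a k) → (∀ k ∈ B, b k = a k) →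
      ∑ k ∈ A, ∑ t ∈ B, (p : ℝ) ^ (-|b k - b t|) =
        ∑ k ∈ A, ∑ t ∈ B, (p : ℝ) ^ (-|a k - a t|) := fun A B hA hB =>
    Finset.sum_congr rfl fun k hk => Finset.sum_congr rfl fun t ht => by rw [hA k hk, hB t ht]
  have c1 : ∑ k ∈ Finset.range (i + 1), ∑ t ∈ Finset.Ioo i j, (p : ℝ) ^ (b k - b t) =
      ∑ k ∈ Finset.range (i + 1), ∑ t ∈ Finset.Ioo i j, (p : ℝ) ^ (a k - b t) :=
    Finset.sum_congr rfl fun k hk => by rw [hl k hk]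
  have c2 : ∑ k ∈ Finset.Ico j r, ∑ t ∈ Finset.Ioo i j, (p : ℝ) ^ (b t - b k) =
      ∑ k ∈ Finset.Ico j r, ∑ t ∈ Finset.Ioo i j, (p : ℝ) ^ (b t - a k) :=
    Finset.sum_congr rfl fun k hk => by rw [hr k hk]
  have ea := two_mul_hp_add (p := p) ha
  have eb := two_mul_hp_add (p := p) hb
  rw [expand a ha] at ea
  rw [expand b hb, outer _ _ hl hl, outer _ _ hl hr, outer _ _ hr hr, hin, c1, c2] at eb
  linarith

theorem sum_Ioo_reflect {M : Type*} [AddCommMonoid M] (i j : ℕ) (f : ℕ → M) :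
    ∑ t ∈ Finset.Ioo i j, f (i + j - t) = ∑ t ∈ Finset.Ioo i j, f t := by
  refine Finset.sum_nbij' (fun t => i + j - t) (fun t => i + j - t) ?_ ?_ ?_ ?_ ?_ <;>
    intro t ht <;> simp only [Finset.mem_Ioo] at * <;> first | rfl | omega

/-- Reversing the gaps between the entries `i` and `j` cannot improve a minimizer. -/
theorem IsMinimizer.reversal {p s r : ℕ} {a : ℕ → ℤ} (hp0 : 0 < p) (ha : IsMinimizer p s r a)
    {i j : ℕ} (hij : i < j) (hj : j < r) :
    0 ≤ (∑ k ∈ Finset.range (i + 1), (p : ℝ) ^ (a k - a i) -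
        ∑ k ∈ Finset.Ico j r, (p : ℝ) ^ (a j - a k)) *
      (∑ t ∈ Finset.Ioo i j, (p : ℝ) ^ (a t - a j) -
        ∑ t ∈ Finset.Ioo i j, (p : ℝ) ^ (a i - a t)) := by
  have hP : (p : ℝ) ≠ 0 := by positivity
  set b : ℕ → ℤ := fun t => if t ∈ Finset.Ioo i j then a i + a j - a (i + j - t) else a t with hbdef
  have hab : ∀ t, t ∉ Finset.Ioo i j → b t = a t := fun t ht => if_neg ht
  have hbin : ∀ t, i ≤ t → t ≤ j → b t = a i + a j - a (i + j - t) := by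
    intro t h1 h2
    simp only [hbdef, Finset.mem_Ioo]
    split_ifs with h
    · rfl
    · obtain rfl | rfl : t = i ∨ t = j := by omega
      · simp
      · simp
  have hb : Admissible s r b := by
    refine ⟨?_, ?_, fun t ht => ?_⟩
    · rw [hab _ (by simp), ha.1.1]
    · rw [hab _ (by simp; omega), ha.1.2.1]
    · by_cases h : i ≤ t ∧ t < j
      · rw [hbin t h.1 h.2.le, hbin (t + 1) (by omega) (by omega)]
        have := ha.1.2.2 (i + j - (t + 1)) (by omega)
        rw [show i + j - (t + 1) + 1 = i + j - t by omega] at this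
        omega
      · rw [hab t (by simp; omega), hab (t + 1) (by simp; omega)]
        exact ha.1.2.2 t ht
  have hbm : ∀ t ∈ Finset.Ioo i j, b t = a i + a j - a (i + j - t) := fun t ht => if_pos ht
  have hin : ∑ k ∈ Finset.Ioo i j, ∑ t ∈ Finset.Ioo i j, (p : ℝ) ^ (-|b k - b t|) =
      ∑ k ∈ Finset.Ioo i j, ∑ t ∈ Finset.Ioo i j, (p : ℝ) ^ (-|a k - a t|) := by
    rw [← sum_Ioo_reflect i j (fun k => ∑ t ∈ Finset.Ioo i j, (p : ℝ) ^ (-|a k - a t|))]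
    refine Finset.sum_congr rfl fun k hk => ?_
    rw [← sum_Ioo_reflect i j (fun t => (p : ℝ) ^ (-|a (i + j - k) - a t|))]
    refine Finset.sum_congr rfl fun t ht => ?_
    rw [hbm k hk, hbm t ht, abs_sub_comm]
    congr 3
    ring
  have hdiff := hp_sub_hp (p := p) ha.1 hb hij hj hab hin
  have hmin := ha.2 b hb
  have l1 : ∑ k ∈ Finset.range (i + 1), ∑ t ∈ Finset.Ioo i j, (p : ℝ) ^ (a k - b t) =
      (∑ k ∈ Finset.range (i + 1), (p : ℝ) ^ (a k - a i)) *
        ∑ t ∈ Finset.Ioo i j, (p : ℝ) ^ (a t - a j) := by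
    rw [Finset.sum_mul_sum]
    refine Finset.sum_congr rfl fun k _ => ?_
    rw [← sum_Ioo_reflect i j (fun t => (p : ℝ) ^ (a k - a i) * (p : ℝ) ^ (a t - a j))]
    refine Finset.sum_congr rfl fun t ht => ?_
    rw [hbm t ht, ← zpow_add₀ hP]
    congr 1
    ring
  have l2 : ∑ k ∈ Finset.range (i + 1), ∑ t ∈ Finset.Ioo i j, (p : ℝ) ^ (a k - a t) =
      (∑ k ∈ Finset.range (i + 1), (p : ℝ) ^ (a k - a i)) *
        ∑ t ∈ Finset.Ioo i j, (p : ℝ) ^ (a i - a t) := by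
    rw [Finset.sum_mul_sum]
    refine Finset.sum_congr rfl fun k _ => Finset.sum_congr rfl fun t _ => ?_
    rw [← zpow_add₀ hP]
    congr 1
    ring
  have l3 : ∑ k ∈ Finset.Ico j r, ∑ t ∈ Finset.Ioo i j, (p : ℝ) ^ (b t - a k) =
      (∑ k ∈ Finset.Ico j r, (p : ℝ) ^ (a j - a k)) *
        ∑ t ∈ Finset.Ioo i j, (p : ℝ) ^ (a i - a t) := by
    rw [Finset.sum_mul_sum]
    refine Finset.sum_congr rfl fun k _ => ?_
    rw [← sum_Ioo_reflect i j (fun t => (p : ℝ) ^ (a j - a k) * (p : ℝ) ^ (a i - a t))]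
    refine Finset.sum_congr rfl fun t ht => ?_
    rw [hbm t ht, ← zpow_add₀ hP]
    congr 1
    ring
  have l4 : ∑ k ∈ Finset.Ico j r, ∑ t ∈ Finset.Ioo i j, (p : ℝ) ^ (a t - a k) =
      (∑ k ∈ Finset.Ico j r, (p : ℝ) ^ (a j - a k)) *
        ∑ t ∈ Finset.Ioo i j, (p : ℝ) ^ (a t - a j) := by
    rw [Finset.sum_mul_sum]
    refine Finset.sum_congr rfl fun k _ => Finset.sum_congr rfl fun t _ => ?_
    rw [← zpow_add₀ hP]
    congr 1
    ring
  rw [l1, l2, l3, l4] at hdiff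
  linarith

/-- Shifting the entries strictly between `i` and `j` by `ε` cannot improve a minimizer. -/
theorem IsMinimizer.shift {p s r : ℕ} {a : ℕ → ℤ} (hp0 : 0 < p) (ha : IsMinimizer p s r a)
    {i j : ℕ} (hij : i + 1 < j) (hj : j < r) (ε : ℤ) (hi : 0 < dlt a i + ε)
    (hjε : 0 < dlt a (j - 1) - ε) :
    0 ≤ ((p : ℝ) ^ (-ε) - 1) *
        ∑ k ∈ Finset.range (i + 1), ∑ t ∈ Finset.Ioo i j, (p : ℝ) ^ (a k - a t) +
      ((p : ℝ) ^ ε - 1) *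
        ∑ k ∈ Finset.Ico j r, ∑ t ∈ Finset.Ioo i j, (p : ℝ) ^ (a t - a k) := by
  have hP : (p : ℝ) ≠ 0 := by positivity
  set b : ℕ → ℤ := fun t => if t ∈ Finset.Ioo i j then a t + ε else a t with hbdef
  have hab : ∀ t, t ∉ Finset.Ioo i j → b t = a t := fun t ht => if_neg ht
  have hbm : ∀ t ∈ Finset.Ioo i j, b t = a t + ε := fun t ht => if_pos ht
  unfold dlt at hi hjε
  rw [show j - 1 + 1 = j by omega] at hjε
  have hb : Admissible s r b := by
    refine ⟨?_, ?_, fun t ht => ?_⟩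
    · rw [hab _ (by simp), ha.1.1]
    · rw [hab _ (by simp; omega), ha.1.2.1]
    · have := ha.1.2.2 t ht
      simp only [hbdef, Finset.mem_Ioo]
      split_ifs with h1 h2 h2
      · omega
      · obtain rfl : t = j - 1 := by omega
        rw [show j - 1 + 1 = j by omega] at *
        omega
      · obtain rfl : t = i := by omega
        omega
      · omega
  have hin : ∑ k ∈ Finset.Ioo i j, ∑ t ∈ Finset.Ioo i j, (p : ℝ) ^ (-|b k - b t|) =
      ∑ k ∈ Finset.Ioo i j, ∑ t ∈ Finset.Ioo i j, (p : ℝ) ^ (-|a k - a t|) := by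
    refine Finset.sum_congr rfl fun k hk => Finset.sum_congr rfl fun t ht => ?_
    rw [hbm k hk, hbm t ht, add_sub_add_right_eq_sub]
  have hdiff := hp_sub_hp (p := p) ha.1 hb (by omega) hj hab hin
  have hmin := ha.2 b hb
  have l1 : ∑ k ∈ Finset.range (i + 1), ∑ t ∈ Finset.Ioo i j, (p : ℝ) ^ (a k - b t) =
      (p : ℝ) ^ (-ε) *
        ∑ k ∈ Finset.range (i + 1), ∑ t ∈ Finset.Ioo i j, (p : ℝ) ^ (a k - a t) := by
    rw [Finset.mul_sum]
    refine Finset.sum_congr rfl fun k _ => ?_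
    rw [Finset.mul_sum]
    refine Finset.sum_congr rfl fun t ht => ?_
    rw [hbm t ht, ← zpow_add₀ hP]
    congr 1
    ring
  have l3 : ∑ k ∈ Finset.Ico j r, ∑ t ∈ Finset.Ioo i j, (p : ℝ) ^ (b t - a k) =
      (p : ℝ) ^ ε *
        ∑ k ∈ Finset.Ico j r, ∑ t ∈ Finset.Ioo i j, (p : ℝ) ^ (a t - a k) := by
    rw [Finset.mul_sum]
    refine Finset.sum_congr rfl fun k _ => ?_
    rw [Finset.mul_sum]
    refine Finset.sum_congr rfl fun t ht => ?_
    rw [hbm t ht, ← zpow_add₀ hP]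
    congr 1
    ring
  rw [l1, l3] at hdiff
  linarith

theorem sum_zpow_Ico_le {P : ℝ} (hP : 3 ≤ P) {v : ℕ → ℤ} {K V : ℕ} {c₀ : ℤ}
    (hv : ∀ c, K ≤ c → c < V → v c ≤ c₀ - ((c : ℤ) - K)) :
    ∑ c ∈ Finset.Ico K V, P ^ v c ≤ P ^ c₀ * (3 / 2) := by
  have hP0 : 0 < P := by linarith
  rw [Finset.sum_Ico_eq_sum_range]
  have hinv : P⁻¹ ≤ 1 / 3 := by
    rw [inv_eq_one_div]
    exact one_div_le_one_div_of_le (by norm_num) hP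
  have hinv0 : 0 < P⁻¹ := by positivity
  calc ∑ c ∈ Finset.range (V - K), P ^ v (K + c)
      ≤ ∑ c ∈ Finset.range (V - K), P ^ c₀ * P⁻¹ ^ c := by
        refine Finset.sum_le_sum fun c hc => ?_
        rw [Finset.mem_range] at hc
        have h := hv (K + c) (by omega) (by omega)
        rw [inv_pow, ← zpow_natCast, ← zpow_neg, ← zpow_add₀ hP0.ne']
        refine zpow_le_zpow_right₀ (by linarith) ?_
        push_cast at h
        omega
    _ = P ^ c₀ * ∑ c ∈ Finset.range (V - K), P⁻¹ ^ c := by rw [Finset.mul_sum]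
    _ ≤ P ^ c₀ * (3 / 2) := by
        refine mul_le_mul_of_nonneg_left ?_ (by positivity)
        have h1 := (summable_geometric_of_lt_one hinv0.le (by linarith)).sum_le_tsum
          (Finset.range (V - K)) (fun c _ => by positivity)
        rw [tsum_geometric_of_lt_one hinv0.le (by linarith)] at h1
        refine h1.trans ?_
        rw [inv_le_comm₀ (by linarith) (by norm_num)]
        linarith

/-- Lexicographic comparison of sums of powers with decreasing exponents: the first
exponent that differs decides. -/
theorem sum_zpow_lt {P : ℝ} (hP : 3 ≤ P) {u v : ℕ → ℤ} {U V K : ℕ} (hKU : K < U)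
    (heq : ∀ c < K, c < V → v c = u c) (hlt : K < V → v K < u K)
    (hv : ∀ c, K ≤ c → c < V → v c ≤ v K - ((c : ℤ) - K)) :
    ∑ c ∈ Finset.range V, P ^ v c < ∑ c ∈ Finset.range U, P ^ u c := by
  have hP0 : 0 < P := by linarith
  have hU : ∑ c ∈ Finset.range (K + 1), P ^ u c ≤ ∑ c ∈ Finset.range U, P ^ u c :=
    Finset.sum_le_sum_of_subset_of_nonneg (Finset.range_subset_range.2 hKU)
      fun _ _ _ => by positivity
  refine lt_of_lt_of_le ?_ hU
  rw [Finset.sum_range_succ]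
  have huK : 0 < P ^ u K := by positivity
  by_cases hKV : K < V
  · rw [← Finset.sum_range_add_sum_Ico _ hKV.le]
    rw [Finset.sum_congr rfl (g := fun c => P ^ u c) fun c hc => by
      rw [Finset.mem_range] at hc
      rw [heq c hc (by omega)]]
    have h1 := sum_zpow_Ico_le hP hv
    have h2 : P ^ v K * 3 ≤ P ^ u K := by
      calc P ^ v K * 3 ≤ P ^ v K * P := mul_le_mul_of_nonneg_left hP (by positivity)
        _ = P ^ (v K + 1) := (zpow_add_one₀ hP0.ne' _).symm
        _ ≤ P ^ u K := zpow_le_zpow_right₀ (by linarith) (hlt hKV)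
    linarith
  · calc ∑ c ∈ Finset.range V, P ^ v c = ∑ c ∈ Finset.range V, P ^ u c :=
        Finset.sum_congr rfl fun c hc => by
          rw [Finset.mem_range] at hc
          rw [heq c (by omega) hc]
      _ ≤ ∑ c ∈ Finset.range K, P ^ u c :=
        Finset.sum_le_sum_of_subset_of_nonneg (Finset.range_subset_range.2 (by omega))
          fun _ _ _ => by positivity
      _ < _ := by linarith

theorem sum_range_succ_reflect {M : Type*} [AddCommMonoid M] (i : ℕ) (f : ℕ → M) :
    ∑ k ∈ Finset.range (i + 1), f k = ∑ c ∈ Finset.range (i + 1), f (i - c) := by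
  rw [← Finset.sum_range_reflect]
  simp

theorem sum_Ioo_eq_sum_range {M : Type*} [AddCommMonoid M] (i j : ℕ) (f : ℕ → M) :
    ∑ t ∈ Finset.Ioo i j, f t = ∑ c ∈ Finset.range (j - (i + 1)), f (i + 1 + c) := by
  rw [← Finset.sum_Ico_eq_sum_range]
  congr 1

theorem sum_Ioo_eq_sum_range' {M : Type*} [AddCommMonoid M] (i j : ℕ) (f : ℕ → M) :
    ∑ t ∈ Finset.Ioo i j, f t = ∑ c ∈ Finset.range (j - (i + 1)), f (j - 1 - c) := by
  rw [← sum_Ioo_reflect, sum_Ioo_eq_sum_range]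
  refine Finset.sum_congr rfl fun c _ => ?_
  congr 1
  omega

theorem Admissible.dlt_pos {s r : ℕ} {a : ℕ → ℤ} (h : Admissible s r a) {t : ℕ}
    (ht : t + 1 < r) : 0 < dlt a t := by
  have := h.2.2 t ht
  unfold dlt
  omega

theorem Admissible.sum_left_le {p s r : ℕ} (hp3 : 3 ≤ p) {a : ℕ → ℤ} (h : Admissible s r a)
    {i j : ℕ} (hij : i + 1 < j) (hj : j < r) :
    ∑ k ∈ Finset.range (i + 1), ∑ t ∈ Finset.Ioo i j, (p : ℝ) ^ (a k - a t) ≤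
      (p : ℝ) ^ (-dlt a i) * (9 / 4) := by
  have hP : (3 : ℝ) ≤ p := by exact_mod_cast hp3
  have hP0 : (p : ℝ) ≠ 0 := by positivity
  have e : ∑ k ∈ Finset.range (i + 1), ∑ t ∈ Finset.Ioo i j, (p : ℝ) ^ (a k - a t) =
      (∑ k ∈ Finset.range (i + 1), (p : ℝ) ^ (a k - a i)) *
        ∑ t ∈ Finset.Ioo i j, (p : ℝ) ^ (a i - a t) := by
    rw [Finset.sum_mul_sum]
    refine Finset.sum_congr rfl fun k _ => Finset.sum_congr rfl fun t _ => ?_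
    rw [← zpow_add₀ hP0]
    congr 1
    ring
  have h1 : ∑ k ∈ Finset.range (i + 1), (p : ℝ) ^ (a k - a i) ≤ (p : ℝ) ^ (0 : ℤ) * (3 / 2) := by
    rw [sum_range_succ_reflect, Finset.range_eq_Ico]
    refine sum_zpow_Ico_le hP fun c _ hc => ?_
    have := h.add_sub_le (show i - c ≤ i by omega) (by omega)
    push_cast [show c ≤ i by omega] at this ⊢
    omega
  have h2 : ∑ t ∈ Finset.Ioo i j, (p : ℝ) ^ (a i - a t) ≤ (p : ℝ) ^ (-dlt a i) * (3 / 2) := by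
    refine sum_zpow_Ico_le (K := i + 1) hP fun c hc hcj => ?_
    have := h.add_sub_le hc (by omega)
    unfold dlt
    push_cast at this ⊢
    omega
  rw [e]
  calc _ ≤ ((p : ℝ) ^ (0 : ℤ) * (3 / 2)) * ((p : ℝ) ^ (-dlt a i) * (3 / 2)) :=
        mul_le_mul h1 h2 (Finset.sum_nonneg fun _ _ => by positivity) (by positivity)
    _ = _ := by rw [zpow_zero]; ring

theorem Admissible.sum_right_le {p s r : ℕ} (hp3 : 3 ≤ p) {a : ℕ → ℤ} (h : Admissible s r a)
    {i j : ℕ} (hij : i + 1 < j) (hj : j < r) :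
    ∑ k ∈ Finset.Ico j r, ∑ t ∈ Finset.Ioo i j, (p : ℝ) ^ (a t - a k) ≤
      (p : ℝ) ^ (-dlt a (j - 1)) * (9 / 4) := by
  have hP : (3 : ℝ) ≤ p := by exact_mod_cast hp3
  have hP0 : (p : ℝ) ≠ 0 := by positivity
  have e : ∑ k ∈ Finset.Ico j r, ∑ t ∈ Finset.Ioo i j, (p : ℝ) ^ (a t - a k) =
      (∑ k ∈ Finset.Ico j r, (p : ℝ) ^ (a j - a k)) *
        ∑ t ∈ Finset.Ioo i j, (p : ℝ) ^ (a t - a j) := by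
    rw [Finset.sum_mul_sum]
    refine Finset.sum_congr rfl fun k _ => Finset.sum_congr rfl fun t _ => ?_
    rw [← zpow_add₀ hP0]
    congr 1
    ring
  have h1 : ∑ k ∈ Finset.Ico j r, (p : ℝ) ^ (a j - a k) ≤ (p : ℝ) ^ (0 : ℤ) * (3 / 2) := by
    refine sum_zpow_Ico_le hP fun c hjc hc => ?_
    have := h.add_sub_le hjc hc
    omega
  have h2 : ∑ t ∈ Finset.Ioo i j, (p : ℝ) ^ (a t - a j) ≤
      (p : ℝ) ^ (-dlt a (j - 1)) * (3 / 2) := by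
    rw [sum_Ioo_eq_sum_range', Finset.range_eq_Ico]
    refine sum_zpow_Ico_le hP fun c _ hc => ?_
    have := h.add_sub_le (show j - 1 - c ≤ j - 1 by omega) (by omega)
    unfold dlt
    rw [show j - 1 + 1 = j by omega]
    push_cast [show c ≤ j - 1 by omega, show 1 ≤ j by omega] at this ⊢
    omega
  rw [e]
  calc _ ≤ ((p : ℝ) ^ (0 : ℤ) * (3 / 2)) * ((p : ℝ) ^ (-dlt a (j - 1)) * (3 / 2)) :=
        mul_le_mul h1 h2 (Finset.sum_nonneg fun _ _ => by positivity) (by positivity)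
    _ = _ := by rw [zpow_zero]; ring

theorem le_sum_left {p : ℕ} (a : ℕ → ℤ) {i j : ℕ} (hij : i + 1 < j) :
    (p : ℝ) ^ (-dlt a i) ≤
      ∑ k ∈ Finset.range (i + 1), ∑ t ∈ Finset.Ioo i j, (p : ℝ) ^ (a k - a t) := by
  refine le_trans ?_ (Finset.single_le_sum (fun k _ => Finset.sum_nonneg fun _ _ => by positivity)
    (Finset.self_mem_range_succ i))
  refine le_trans (le_of_eq ?_) (Finset.single_le_sum (fun k _ => by positivity)
    (Finset.mem_Ioo.2 ⟨Nat.lt_succ_self i, hij⟩))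
  simp [dlt]

theorem le_sum_right {p r : ℕ} (a : ℕ → ℤ) {i j : ℕ} (hij : i + 1 < j) (hj : j < r) :
    (p : ℝ) ^ (-dlt a (j - 1)) ≤
      ∑ k ∈ Finset.Ico j r, ∑ t ∈ Finset.Ioo i j, (p : ℝ) ^ (a t - a k) := by
  refine le_trans ?_ (Finset.single_le_sum (fun k _ => Finset.sum_nonneg fun _ _ => by positivity)
    (Finset.mem_Ico.2 ⟨le_rfl, hj⟩))
  refine le_trans (le_of_eq ?_) (Finset.single_le_sum (fun k _ => by positivity)
    (Finset.mem_Ioo.2 ⟨show i < j - 1 by omega, by omega⟩))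
  simp [dlt, show j - 1 + 1 = j by omega]

/-- The numerical core of the balancing step. -/
theorem not_shift_improves {P X Y : ℝ} (hP : 3 ≤ P) {u v : ℤ} (huv : v + 2 ≤ u)
    (hX : X ≤ P ^ (-u) * (9 / 4)) (hY : P ^ (-v) ≤ Y) :
    (P - 1) * X + (P⁻¹ - 1) * Y < 0 := by
  have hP0 : 0 < P := by linarith
  have h1 : P ^ (-u) * P ^ 2 ≤ P ^ (-v) := by
    rw [← zpow_natCast, ← zpow_add₀ hP0.ne']
    exact zpow_le_zpow_right₀ (by linarith) (by push_cast; omega)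
  have hu : 0 < P ^ (-u) := by positivity
  have hinv : P⁻¹ < 1 := inv_lt_one_of_one_lt₀ (by linarith)
  calc (P - 1) * X + (P⁻¹ - 1) * Y
      ≤ (P - 1) * (P ^ (-u) * (9 / 4)) + (P⁻¹ - 1) * (P ^ (-u) * P ^ 2) :=
        add_le_add (mul_le_mul_of_nonneg_left hX (by linarith))
          (mul_le_mul_of_nonpos_left (h1.trans hY) (by linarith))
    _ = (P - 1) * P ^ (-u) * (9 / 4 - P) := by field_simp; ring
    _ < 0 := mul_neg_of_pos_of_neg (mul_pos (by linarith) hu) (by linarith)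

/-- The gaps of a minimizer differ by at most one. -/
theorem IsMinimizer.dlt_le {p s r : ℕ} {a : ℕ → ℤ} (hp3 : 3 ≤ p) (ha : IsMinimizer p s r a)
    {u v : ℕ} (hu : u < r - 1) (hv : v < r - 1) : dlt a u ≤ dlt a v + 1 := by
  have hP : (3 : ℝ) ≤ p := by exact_mod_cast hp3
  by_contra! hlt
  have hvpos := ha.1.dlt_pos (show v + 1 < r by omega)
  rcases lt_trichotomy u v with h | rfl | h
  · have key := ha.shift (by omega) (show u + 1 < v + 1 by omega) (by omega) (-1) (by omega)
      (by rw [Nat.add_sub_cancel]; omega)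
    have hX := ha.1.sum_left_le hp3 (show u + 1 < v + 1 by omega) (by omega)
    have hY := le_sum_right (p := p) (r := r) a (show u + 1 < v + 1 by omega) (by omega)
    rw [Nat.add_sub_cancel] at hY
    have := not_shift_improves hP (by omega) hX hY
    rw [neg_neg, zpow_one, zpow_neg_one] at key
    linarith
  · omega
  · have key := ha.shift (by omega) (show v + 1 < u + 1 by omega) (by omega) 1 (by omega)
      (by rw [Nat.add_sub_cancel]; omega)
    have hX := ha.1.sum_right_le hp3 (show v + 1 < u + 1 by omega) (by omega)
    have hY := le_sum_left (p := p) a (show v + 1 < u + 1 by omega)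
    rw [Nat.add_sub_cancel] at hX
    have := not_shift_improves hP (by omega) hX hY
    rw [zpow_one, zpow_neg_one] at key
    linarith

theorem sub_eq_sub_of_dlt_eq {a : ℕ → ℤ} {i j c : ℕ} (hci : c ≤ i)
    (h : ∀ c' < c, dlt a (i - 1 - c') = dlt a (j + c')) :
    a i - a (i - c) = a (j + c) - a j := by
  induction c with
  | zero => simp
  | succ c ih =>
    have h1 := ih (by omega) fun c' hc' => h c' (by omega)
    have h2 := h c (by omega)
    unfold dlt at h2
    rw [show i - 1 - c + 1 = i - c by omega, show i - 1 - c = i - (c + 1) by omega] at h2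
    rw [← add_assoc j c 1]
    omega

/-- A factor that starts with a shorter gap than it ends with has no smaller gaps on its left
than on its right at the first difference. -/
theorem IsMinimizer.not_lt_left {p s r : ℕ} {a : ℕ → ℤ} (hp3 : 3 ≤ p) (ha : IsMinimizer p s r a)
    {i j l : ℕ} (hij : i + 1 < j) (hj : j < r) (hF : dlt a i < dlt a (j - 1)) (hl : l < i)
    (heq : ∀ c < l, j + c + 1 < r → dlt a (i - 1 - c) = dlt a (j + c))
    (hlt : j + l + 1 < r → dlt a (i - 1 - l) < dlt a (j + l)) : False := by
  have hP : (3 : ℝ) ≤ p := by exact_mod_cast hp3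
  have key := ha.reversal (by omega) (show i < j by omega) hj
  refine key.not_gt (mul_neg_of_pos_of_neg ?_ ?_)
  · rw [sub_pos, sum_range_succ_reflect, Finset.sum_Ico_eq_sum_range]
    refine sum_zpow_lt hP (K := l + 1) (by omega) (fun c hc hcr => ?_) (fun hr => ?_)
      fun c hc hcr => ?_
    · have := sub_eq_sub_of_dlt_eq (a := a) (i := i) (j := j) (c := c) (by omega)
        fun c' hc' => heq c' (by omega) (by omega)
      omega
    · have h1 := sub_eq_sub_of_dlt_eq (a := a) (i := i) (j := j) (c := l) (by omega)
        fun c' hc' => heq c' (by omega) (by omega)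
      have h2 := hlt (by omega)
      unfold dlt at h2
      rw [show i - 1 - l + 1 = i - l by omega, show i - 1 - l = i - (l + 1) by omega] at h2
      rw [← add_assoc j l 1]
      omega
    · have := ha.1.add_sub_le (show j + (l + 1) ≤ j + c by omega) (by omega)
      push_cast at this ⊢
      omega
  · rw [sub_neg, sum_Ioo_eq_sum_range', sum_Ioo_eq_sum_range]
    refine sum_zpow_lt hP (K := 0) (by omega) (fun c hc => by omega) (fun hr => ?_)
      fun c hc hcr => ?_
    · unfold dlt at hF
      rw [show j - 1 + 1 = j by omega] at hF
      simp only [add_zero, Nat.sub_zero]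
      omega
    · have := ha.1.add_sub_le (show j - 1 - c ≤ j - 1 by omega) (by omega)
      push_cast [show c ≤ j - 1 by omega, show 1 ≤ j by omega] at this ⊢
      simp only [Nat.sub_zero]
      omega

/-- Mirror image of `IsMinimizer.not_lt_left`. -/
theorem IsMinimizer.not_lt_right {p s r : ℕ} {a : ℕ → ℤ} (hp3 : 3 ≤ p) (ha : IsMinimizer p s r a)
    {i j l : ℕ} (hij : i + 1 < j) (hF : dlt a (j - 1) < dlt a i) (hl : j + l + 1 < r)
    (heq : ∀ c < l, c < i → dlt a (i - 1 - c) = dlt a (j + c))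
    (hlt : l < i → dlt a (j + l) < dlt a (i - 1 - l)) : False := by
  have hP : (3 : ℝ) ≤ p := by exact_mod_cast hp3
  have key := ha.reversal (by omega) (show i < j by omega) (show j < r by omega)
  refine key.not_gt (mul_neg_of_neg_of_pos ?_ ?_)
  · rw [sub_neg, sum_range_succ_reflect, Finset.sum_Ico_eq_sum_range]
    refine sum_zpow_lt hP (K := l + 1) (by omega) (fun c hc hcr => ?_) (fun hr => ?_)
      fun c hc hcr => ?_
    · have := sub_eq_sub_of_dlt_eq (a := a) (i := i) (j := j) (c := c) (by omega)
        fun c' hc' => heq c' (by omega) (by omega)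
      omega
    · have h1 := sub_eq_sub_of_dlt_eq (a := a) (i := i) (j := j) (c := l) (by omega)
        fun c' hc' => heq c' (by omega) (by omega)
      have h2 := hlt (by omega)
      unfold dlt at h2
      rw [show i - 1 - l + 1 = i - l by omega, show i - 1 - l = i - (l + 1) by omega] at h2
      rw [← add_assoc j l 1]
      omega
    · have := ha.1.add_sub_le (show i - c ≤ i - (l + 1) by omega) (by omega)
      push_cast [show c ≤ i by omega, show l + 1 ≤ i by omega] at this ⊢
      omega
  · rw [sub_pos, sum_Ioo_eq_sum_range, sum_Ioo_eq_sum_range']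
    refine sum_zpow_lt hP (K := 0) (by omega) (fun c hc => by omega) (fun hr => ?_)
      fun c hc hcr => ?_
    · unfold dlt at hF
      rw [show j - 1 + 1 = j by omega] at hF
      simp only [add_zero, Nat.sub_zero]
      omega
    · have := ha.1.add_sub_le (show i + 1 ≤ i + 1 + c by omega) (by omega)
      push_cast at this ⊢
      simp only [add_zero]
      omega

/-- An integer sequence whose values differ by at most one is determined, up to order, by
its sum. -/
theorem balanced_values {B Q ρ : ℕ} (hρ : ρ < B) {f : ℕ → ℤ}
    (hbal : ∀ x < B, ∀ y < B, f x ≤ f y + 1)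
    (hsum : ∑ x ∈ Finset.range B, f x = (B * Q + ρ : ℕ)) :
    (∀ x < B, f x = Q ∨ f x = Q + 1) ∧
      ((Finset.range B).filter (fun x => f x = Q)).card = B - ρ ∧
      ((Finset.range B).filter (fun x => f x = Q + 1)).card = ρ := by
  have hval : ∀ x < B, f x = Q ∨ f x = Q + 1 := by
    intro x hx
    by_contra! hne
    rcases lt_or_gt_of_ne hne.1 with h | h
    · have : ∑ y ∈ Finset.range B, f y < ∑ y ∈ Finset.range B, (Q : ℤ) := by
        refine Finset.sum_lt_sum (fun y hy => ?_) ⟨x, Finset.mem_range.2 hx, h⟩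
        have := hbal y (Finset.mem_range.1 hy) x hx
        omega
      rw [hsum, Finset.sum_const, Finset.card_range, nsmul_eq_mul] at this
      push_cast at this
      omega
    · have : ∑ y ∈ Finset.range B, ((Q : ℤ) + 1) < ∑ y ∈ Finset.range B, f y := by
        refine Finset.sum_lt_sum (fun y hy => ?_) ⟨x, Finset.mem_range.2 hx, ?_⟩
        · have := hbal x hx y (Finset.mem_range.1 hy)
          omega
        · omega
      rw [hsum, Finset.sum_const, Finset.card_range, nsmul_eq_mul, mul_add] at this
      push_cast at this
      omega
  have hone : ((Finset.range B).filter (fun x => f x = Q + 1)).card = ρ := by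
    have h1 : ∑ x ∈ Finset.range B, f x =
        ∑ x ∈ Finset.range B, ((Q : ℤ) + if f x = Q + 1 then 1 else 0) := by
      refine Finset.sum_congr rfl fun x hx => ?_
      rcases hval x (Finset.mem_range.1 hx) with h | h <;> simp [h]
    rw [hsum, Finset.sum_add_distrib, Finset.sum_boole, Finset.sum_const, Finset.card_range,
      nsmul_eq_mul] at h1
    push_cast at h1
    omega
  refine ⟨hval, ?_, hone⟩
  have h2 := Finset.card_filter_add_card_filter_not (s := Finset.range B) (fun x => f x = Q + 1)
  have h3 : (Finset.range B).filter (fun x => ¬ f x = Q + 1) =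
      (Finset.range B).filter (fun x => f x = Q) := by
    refine Finset.filter_congr fun x hx => ?_
    rcases hval x (Finset.mem_range.1 hx) with h | h <;> simp [h]
  rw [h3, Finset.card_range] at h2
  omega

theorem exists_enumeration (n : ℕ) (q : ℕ → Prop) [DecidablePred q] :
    ∃ z : ℕ → ℕ, (∀ k < ((Finset.range n).filter q).card, z k < n ∧ q (z k)) ∧
      (∀ k k', k < k' → k' < ((Finset.range n).filter q).card → z k < z k') ∧
      ∀ j < n, q j → ∃ k < ((Finset.range n).filter q).card, z k = j := by
  set S := (Finset.range n).filter q with hS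
  refine ⟨fun k => if h : k < S.card then S.orderEmbOfFin rfl ⟨k, h⟩ else 0, ?_, ?_, ?_⟩
  · intro k hk
    have := S.orderEmbOfFin_mem rfl ⟨k, hk⟩
    simp only [dif_pos hk]
    exact ⟨Finset.mem_range.1 (Finset.mem_filter.1 this).1, (Finset.mem_filter.1 this).2⟩
  · intro k k' hkk hk'
    simp [hk', hkk.trans hk', hkk]
  · intro j hj hq
    have hmem : j ∈ Set.range (S.orderEmbOfFin rfl) := by
      rw [Finset.range_orderEmbOfFin]
      simp [hS, hj, hq]
    obtain ⟨⟨k, hk⟩, rfl⟩ := hmem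
    exact ⟨k, hk, by simp [hk]⟩

/-- The extreme gaps of a minimizer with at least two short gaps are short. -/
theorem IsMinimizer.dlt_ends {p s r : ℕ} {a : ℕ → ℤ} (hp3 : 3 ≤ p) (ha : IsMinimizer p s r a)
    {Q : ℤ} (hval : ∀ x < r - 1, dlt a x = Q ∨ dlt a x = Q + 1) {u v : ℕ} (huv : u < v)
    (hv : v < r - 1) (hu : dlt a u = Q) (hvQ : dlt a v = Q) :
    dlt a 0 = Q ∧ dlt a (r - 2) = Q := by
  constructor
  · by_contra h0
    have h0' := (hval 0 (by omega)).resolve_left h0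
    have hpos : u ≠ 0 := by rintro rfl; exact h0 hu
    refine ha.not_lt_right hp3 (i := 0) (j := u + 1) (l := 0) (by omega) ?_ (by omega)
      (fun c hc => by omega) (fun h => by omega)
    rw [Nat.add_sub_cancel]
    omega
  · by_contra h0
    have h0' := (hval (r - 2) (by omega)).resolve_left h0
    have hne : v ≠ r - 2 := by rintro rfl; exact h0 hvQ
    refine ha.not_lt_left hp3 (i := v) (j := r - 1) (l := 0) (by omega) (by omega) ?_ (by omega)
      (fun c hc => by omega) (fun h => by omega)
    rw [show r - 1 - 1 = r - 2 by omega]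
    omega

/-- The blocks of long gaps between consecutive short gaps differ in length by at most one. -/
theorem IsMinimizer.block_balanced {p s r : ℕ} {a : ℕ → ℤ} (hp3 : 3 ≤ p)
    (ha : IsMinimizer p s r a) {Q : ℤ} {u u' w w' : ℕ} (huu : u < u') (huw : u' ≤ w)
    (hww : w < w') (hw' : w' < r - 1) (hu : dlt a u = Q) (hu' : dlt a u' = Q) (hw : dlt a w = Q)
    (hwQ : dlt a w' = Q) (hublock : ∀ x, u < x → x < u' → dlt a x = Q + 1)
    (hwblock : ∀ x, w < x → x < w' → dlt a x = Q + 1) :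
    u' - u ≤ w' - w + 1 ∧ w' - w ≤ u' - u + 1 := by
  constructor
  · by_contra! hlt
    refine ha.not_lt_right hp3 (i := u' - 1) (j := w + 1) (l := w' - w - 1) (by omega) ?_
      (by omega) (fun c hc hci => ?_) (fun hl => ?_)
    · rw [Nat.add_sub_cancel, hw, hublock _ (by omega) (by omega)]
      omega
    · rw [hublock _ (by omega) (by omega), hwblock _ (by omega) (by omega)]
    · rw [show w + 1 + (w' - w - 1) = w' by omega, hwQ, hublock _ (by omega) (by omega)]
      omega
  · by_contra! hlt
    refine ha.not_lt_left hp3 (i := u') (j := w + 2) (l := u' - u - 1) (by omega) (by omega) ?_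
      (by omega) (fun c hc hci => ?_) (fun hl => ?_)
    · rw [hu', hwblock _ (by omega) (by omega)]
      omega
    · rw [hublock _ (by omega) (by omega), hwblock _ (by omega) (by omega)]
    · rw [show u' - 1 - (u' - u - 1) = u by omega, hu, hwblock _ (by omega) (by omega)]
      omega

/-- If `z` enumerates the entries of `d` different from `v`, including the extreme ones, then
the maximal blocks of entries `v` are the gaps of `z`. -/
theorem isMaxRun_iff {n m : ℕ} {d : ℕ → ℤ} {v : ℤ} {z : ℕ → ℕ} (hm : 0 < m)
    (hz : ∀ k < m, z k < n ∧ d (z k) ≠ v)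
    (hmono : ∀ k k', k < k' → k' < m → z k < z k')
    (hsurj : ∀ j < n, d j ≠ v → ∃ k < m, z k = j) (h0 : z 0 = 0) (hlast : z (m - 1) = n - 1)
    {i l : ℕ} :
    IsMaxRun n d v i l ↔
      0 < l ∧ ∃ k < m - 1, z k + 1 = i ∧ z (k + 1) = i + l := by
  have hn : 0 < n := (hz 0 hm).1.pos
  have hd0 : d 0 ≠ v := h0 ▸ (hz 0 hm).2
  have hdn : d (n - 1) ≠ v := hlast ▸ (hz (m - 1) (by omega)).2
  have hle : ∀ k k', k < m → z k < z k' → k < k' := by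
    intro k k' hk hlt
    by_contra! hge
    rcases hge.eq_or_lt with rfl | h
    · omega
    · have := hmono k' k h hk
      omega
  constructor
  · rintro ⟨hl, hil, hv, hleft, hright⟩
    refine ⟨hl, ?_⟩
    have hi : 0 < i := by
      by_contra! h
      obtain rfl : i = 0 := by omega
      exact hd0 (hv 0 hl)
    have hiln : i + l < n := by
      by_contra! h
      refine hdn ?_
      have := hv (l - 1) (by omega)
      rwa [show i + (l - 1) = n - 1 by omega] at this
    obtain ⟨k, hk, hki⟩ := hsurj (i - 1) (by omega) (hleft hi)
    obtain ⟨k', hk', hki'⟩ := hsurj (i + l) hiln (hright hiln)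
    have hkk : k < k' := hle k k' hk (by omega)
    have hkeq : k' = k + 1 := by
      by_contra hne
      have h1 := hmono k (k + 1) (by omega) (by omega)
      have h2 := hmono (k + 1) k' (by omega) hk'
      refine (hz (k + 1) (by omega)).2 ?_
      have := hv (z (k + 1) - i) (by omega)
      rwa [show i + (z (k + 1) - i) = z (k + 1) by omega] at this
    subst hkeq
    exact ⟨k, by omega, by omega, hki'⟩
  · rintro ⟨hl, k, hk, hki, hki'⟩
    have hzk := hz k (by omega)
    have hzk' := hz (k + 1) (by omega)
    refine ⟨hl, by omega, fun c hc => ?_, fun _ => ?_, fun _ => hki' ▸ hzk'.2⟩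
    · by_contra hne
      obtain ⟨k'', hk'', h⟩ := hsurj (i + c) (by omega) hne
      have h1 := hle k k'' (by omega) (by omega)
      have h2 := hle k'' (k + 1) hk'' (by omega)
      omega
    · rw [← hki, Nat.add_sub_cancel]
      exact hzk.2
/-- Theorem 2.2(ii): if `(r-1) ∤ (s-1)`, `(r-1) ∤ s`, `g ≡ s-1 mod (r-1)` is the least
positive residue, `2g ≥ r-1` and `(r-g-2) ∤ g` with `q₂ = g/(r-g-2)`, then the delta
vector `d` of any minimizer has exactly `r-g-1` entries `[q]`, with `d_1 = d_{r-1} = [q]`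
and no two adjacent entries `[q]`; the remaining `g` entries all equal `[q]+1`, appearing
in maximal blocks of length `[q₂]` or `[q₂]+1`, with exactly `e` blocks of length `[q₂]+1`
and exactly `r-g-2-e` blocks of length `[q₂]`, where `e ≡ g mod (r-g-2)` is the least
positive residue. -/
theorem stmt5 (p s r : ℕ) (hpp : p.Prime) (hp3 : 3 ≤ p) (hr : 3 ≤ r) (hrs : r < s)
    (hndvd1 : ¬ (r - 1) ∣ (s - 1)) (hndvd2 : ¬ (r - 1) ∣ s)
    (g : ℕ) (hgdef : g = (s - 1) % (r - 1))
    (hg : r - 1 ≤ 2 * g) (hq2 : ¬ (r - g - 2) ∣ g)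
    (fq : ℤ) (hfq : fq = (((s - 1) / (r - 1) : ℕ) : ℤ))
    (q2f e : ℕ) (hq2f : q2f = g / (r - g - 2)) (he : e = g % (r - g - 2))
    (a : ℕ → ℤ) (ha : IsMinimizer p s r a) :
    ((Finset.range (r - 1)).filter (fun j => dlt a j = fq)).card = r - g - 1 ∧
    dlt a 0 = fq ∧ dlt a (r - 2) = fq ∧
    (∀ j, j + 1 < r - 1 → ¬ (dlt a j = fq ∧ dlt a (j + 1) = fq)) ∧
    (∀ j < r - 1, dlt a j = fq ∨ dlt a j = fq + 1) ∧
    (∀ i l, IsMaxRun (r - 1) (dlt a) (fq + 1) i l → l = q2f ∨ l = q2f + 1) ∧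
    {i | IsMaxRun (r - 1) (dlt a) (fq + 1) i (q2f + 1)}.ncard = e ∧
    {i | IsMaxRun (r - 1) (dlt a) (fq + 1) i q2f}.ncard = r - g - 2 - e := by
  set n := r - 1 with hn
  obtain ⟨hfval, hcard, -⟩ := balanced_values (B := n) (Q := (s - 1) / n) (ρ := g) (f := dlt a)
    (hgdef ▸ Nat.mod_lt _ (by omega)) (fun x hx y hy => ha.dlt_le hp3 hx hy) (by
      unfold dlt
      rw [Finset.sum_range_sub, ha.1.2.1, ha.1.1, hgdef, Nat.div_add_mod]
      push_cast [show 1 ≤ s by omega]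
      ring)
  rw [← hfq] at hfval hcard
  have hgn : g < n := hgdef ▸ Nat.mod_lt _ (by omega)
  have hgn' : g + 1 ≠ n := by
    intro h
    refine hndvd2 ⟨(s - 1) / n + 1, ?_⟩
    have := Nat.div_add_mod (s - 1) n
    rw [mul_add]
    omega
  obtain ⟨z, hz, hmono, hsurj⟩ := exists_enumeration n (fun j => dlt a j = fq)
  set m := ((Finset.range n).filter (fun j => dlt a j = fq)).card with hm
  have hB : r - g - 2 = m - 1 := by omega
  rw [hB] at hq2f he ⊢
  have hm2 : 2 ≤ m := by omega
  have hends := ha.dlt_ends hp3 hfval (hmono 0 1 (by omega) (by omega)) (hz 1 (by omega)).1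
    (hz 0 (by omega)).2 (hz 1 (by omega)).2
  have hz0 : z 0 = 0 := by
    obtain ⟨k, hk, h⟩ := hsurj 0 (by omega) hends.1
    rcases Nat.eq_zero_or_pos k with rfl | hpos
    · exact h
    · have := hmono 0 k hpos hk
      omega
  have hzlast : z (m - 1) = n - 1 := by
    obtain ⟨k, hk, h⟩ := hsurj (n - 1) (by omega) (by rw [hn, Nat.sub_sub]; exact hends.2)
    rcases (show k ≤ m - 1 by omega).eq_or_lt with rfl | hlt
    · exact h
    · have := hmono k (m - 1) hlt (by omega)
      have := (hz (m - 1) (by omega)).1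
      omega
  have hne : ∀ j < n, dlt a j ≠ fq + 1 ↔ dlt a j = fq := by
    intro j hj
    have := hfval j hj
    omega
  have hrun : ∀ i l, IsMaxRun n (dlt a) (fq + 1) i l ↔
      0 < l ∧ ∃ k < m - 1, z k + 1 = i ∧ z (k + 1) = i + l := fun i l =>
    isMaxRun_iff (by omega) (fun k hk => ⟨(hz k hk).1, (hne _ (hz k hk).1).2 (hz k hk).2⟩) hmono
      (fun j hj h => hsurj j hj ((hne j hj).1 h)) hz0 hzlast
  have hblock : ∀ k < m - 1, ∀ x, z k < x → x < z (k + 1) → dlt a x = fq + 1 := by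
    intro k hk x hx hx'
    have hrunk := ((hrun (z k + 1) (z (k + 1) - (z k + 1))).2
      ⟨by omega, k, hk, rfl, by omega⟩).2.2.1 (x - (z k + 1)) (by omega)
    rwa [show z k + 1 + (x - (z k + 1)) = x by omega] at hrunk
  have hstep : ∀ k < m - 1, z k < z (k + 1) := fun k hk => hmono k (k + 1) (by omega) (by omega)
  have hpair : ∀ x y, x < y → y < m - 1 →
      z (x + 1) - z x ≤ z (y + 1) - z y + 1 ∧ z (y + 1) - z y ≤ z (x + 1) - z x + 1 := by
    intro x y hxy hy
    have hxy' : z (x + 1) ≤ z y := by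
      rcases (show x + 1 ≤ y by omega).eq_or_lt with rfl | h
      · exact le_rfl
      · exact (hmono _ _ h (by omega)).le
    exact ha.block_balanced hp3 (hstep x (by omega)) hxy' (hstep y hy) (hz _ (by omega)).1
      (hz _ (by omega)).2 (hz _ (by omega)).2 (hz _ (by omega)).2 (hz _ (by omega)).2
      (hblock x (by omega)) (hblock y hy)
  obtain ⟨hlval, hlcard, hlcard'⟩ := balanced_values (B := m - 1) (Q := g / (m - 1))
    (ρ := g % (m - 1)) (f := fun k => (z (k + 1) : ℤ) - z k - 1) (Nat.mod_lt _ (by omega)) (by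
      intro x hx y hy
      have h1 := hstep x hx
      have h2 := hstep y hy
      rcases lt_trichotomy x y with h | rfl | h
      · have := hpair x y h hy
        omega
      · omega
      · have := hpair y x h hx
        omega) (by
      rw [Finset.sum_sub_distrib, Finset.sum_range_sub (fun k => (z k : ℤ)), hz0, hzlast,
        Nat.div_add_mod]
      simp only [Finset.sum_const, Finset.card_range, nsmul_eq_mul]
      omega)
  rw [← hq2f] at hlval hlcard hlcard'
  rw [← he] at hlcard hlcard'
  have hq2pos : 0 < q2f := hq2f ▸ Nat.div_pos (by omega) (by omega)
  have hcount : ∀ L, 0 < L → {i | IsMaxRun n (dlt a) (fq + 1) i L}.ncard =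
      ((Finset.range (m - 1)).filter (fun k => (z (k + 1) : ℤ) - z k - 1 = L)).card := by
    intro L hL
    have hset : {i | IsMaxRun n (dlt a) (fq + 1) i L} =
        (fun k => z k + 1) ''
          ((Finset.range (m - 1)).filter (fun k => (z (k + 1) : ℤ) - z k - 1 = L) : Set ℕ) := by
      ext i
      simp only [Set.mem_ofPred_eq, hrun, Set.mem_image, Finset.mem_coe, Finset.mem_filter,
        Finset.mem_range]
      constructor
      · rintro ⟨-, k, hk, h1, h2⟩
        exact ⟨k, ⟨hk, by omega⟩, h1⟩
      · rintro ⟨k, ⟨hk, h1⟩, h2⟩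
        exact ⟨hL, k, hk, h2, by omega⟩
    rw [hset, Set.InjOn.ncard_image, Set.ncard_coe_finset]
    intro x hx y hy hxy
    simp only [Finset.coe_filter, Finset.mem_range, Set.mem_ofPred_eq] at hx hy hxy
    rcases lt_trichotomy x y with h | h | h
    · have := hmono x y h (by omega)
      omega
    · exact h
    · have := hmono y x h (by omega)
      omega
  refine ⟨by omega, hends.1, hends.2, ?_, hfval, ?_, ?_, ?_⟩
  · rintro j hj ⟨h1, h2⟩
    obtain ⟨k, hk, rfl⟩ := hsurj j (by omega) h1
    have hk1 : k < m - 1 := by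
      by_contra! h
      obtain rfl : k = m - 1 := by omega
      omega
    have := hlval k hk1
    have h3 := hblock k hk1 (z k + 1) (by omega) (by omega)
    omega
  · intro i l h
    obtain ⟨-, k, hk, h1, h2⟩ := (hrun i l).1 h
    have := hlval k hk
    omega
  · rw [hcount _ (by omega), ← hlcard']
    push_cast
    rfl
  · rw [hcount _ hq2pos, hlcard]
end

section
/- Let p ≥ 3 be a prime and let 3 ≤ r < s be integers such that (r-1) ∤ (s-1) and (r-1) ∤ s. Let g be the least positive residue of s-1 modulo r-1, assume 2g ≤ r-2 and that (g+1) divides r-g-1, and set q_1 = (r-g-1)/(g+1). If a ∈ A(s,r) satisfies h_p(a) = min h_p, then δ(a) = ([q],…,[q] (q_1-fold), [q+1], [q],…,[q] (q_1-fold), [q+1], …, [q],…,[q] (q_1-fold)); that is, δ(a) consists of g+1 blocks each of exactly q_1 consecutive entries [q], separated by the g singleton entries [q+1]. -/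
lemma sub_one_mul_le_zpow_sub_one {x : ℝ} (hx : 2 ≤ x) (y : ℤ) :
    (x - 1) * y ≤ x ^ y - 1 := by
  obtain ⟨n, rfl | rfl⟩ := y.eq_nat_or_neg
  · have h := one_add_mul_le_pow (a := x - 1) (by linarith) n
    rw [add_sub_cancel] at h
    push_cast
    rw [zpow_natCast]
    linarith
  · rcases Nat.eq_zero_or_pos n with rfl | hn
    · simp
    · have h : (0 : ℝ) < x ^ (-(n : ℤ)) := by positivity
      have hn' : (1 : ℝ) ≤ n := by exact_mod_cast hn
      push_cast
      nlinarith

lemma sub_one_mul_le_mul_zpow_sub_one {x : ℝ} (hx : 2 ≤ x) (y : ℤ) :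
    (x - 1) * y ≤ x * (x ^ y - 1) := by
  rcases le_total 0 y with hy | hy
  · have h := sub_one_mul_le_zpow_sub_one hx y
    have hy' : (0 : ℝ) ≤ y := by exact_mod_cast hy
    nlinarith [mul_nonneg (by linarith : (0 : ℝ) ≤ x - 1) hy']
  · obtain ⟨n, rfl⟩ := Int.exists_eq_neg_ofNat hy
    have hx0 : (0 : ℝ) < x := by linarith
    have h := one_add_mul_le_pow (a := x⁻¹ - 1) (by linarith [inv_pos.mpr hx0]) n
    rw [add_sub_cancel, inv_pow, ← zpow_natCast, ← zpow_neg] at h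
    have h2 := mul_le_mul_of_nonneg_left h hx0.le
    have h3 : x * (1 + n * (x⁻¹ - 1)) = x + n * (1 - x) := by field_simp
    push_cast
    linarith

lemma sum_range_ite_lt_left (W : ℕ → ℝ) (i n : ℕ) (hi : i ≤ n) :
    ∑ k ∈ Finset.range (n + 1), (if k < i then W (i - k) else 0) =
      ∑ l ∈ Finset.range i, W (l + 1) := by
  rw [← Finset.sum_filter]
  have : (Finset.range (n + 1)).filter (· < i) = Finset.range i := by
    ext k; simp only [Finset.mem_filter, Finset.mem_range]; omega
  rw [this, ← Finset.sum_range_reflect]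
  refine Finset.sum_congr rfl fun k hk => ?_
  rw [Finset.mem_range] at hk
  congr 1
  omega

lemma sum_range_ite_lt_right (W : ℕ → ℝ) (k n : ℕ) (hk : k ≤ n) :
    ∑ i ∈ Finset.range (n + 1), (if k < i then W (i - k) else 0) =
      ∑ l ∈ Finset.range (n - k), W (l + 1) := by
  rw [← Finset.sum_range_reflect, ← sum_range_ite_lt_left W (n - k) n (by omega)]
  refine Finset.sum_congr rfl fun i hi => ?_
  rw [Finset.mem_range] at hi
  have h : k < n + 1 - 1 - i ↔ i < n - k := by omega
  simp only [h]
  congr 2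
  omega

/-- Summation by parts for weighted differences over all pairs. -/
lemma sum_pairs_weighted_sub (W D : ℕ → ℝ) (n : ℕ) :
    ∑ k ∈ Finset.range (n + 1), ∑ i ∈ Finset.range (n + 1),
      (if k < i then W (i - k) * (D k - D i) else 0) =
    ∑ i ∈ Finset.range (n + 1), D i *
      (∑ l ∈ Finset.range (n - i), W (l + 1) - ∑ l ∈ Finset.range i, W (l + 1)) := by
  have h : ∀ k i : ℕ, (if k < i then W (i - k) * (D k - D i) else 0) =
      D k * (if k < i then W (i - k) else 0) - D i * (if k < i then W (i - k) else 0) := by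
    intro k i
    split_ifs <;> ring
  simp only [h]
  simp only [Finset.sum_sub_distrib, mul_sub]
  congr 1
  · refine Finset.sum_congr rfl fun k hk => ?_
    rw [← Finset.mul_sum, sum_range_ite_lt_right W k n (by simpa [Nat.lt_succ_iff] using hk)]
  · rw [Finset.sum_comm]
    refine Finset.sum_congr rfl fun i hi => ?_
    rw [← Finset.mul_sum, sum_range_ite_lt_left W i n (by simpa [Nat.lt_succ_iff] using hi)]

/-- For rapidly decreasing weights, a tail is dominated by its preceding term. -/
lemma partial_sum_le_add {W : ℕ → ℝ} (hW : ∀ k, 0 < W k) (hdec : ∀ k, 2 * W (k + 1) ≤ W k)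
    (i t : ℕ) :
    ∑ l ∈ Finset.range i, W (l + 1) ≤ ∑ l ∈ Finset.range t, W (l + 1) + W t := by
  rcases le_total i t with h | h
  · have := Finset.sum_le_sum_of_subset_of_nonneg (Finset.range_mono h)
      (fun l _ _ => (hW (l + 1)).le)
    linarith [hW t]
  · suffices ∑ l ∈ Finset.range i, W (l + 1) + W i ≤
        ∑ l ∈ Finset.range t, W (l + 1) + W t by linarith [hW i]
    induction i, h using Nat.le_induction with
    | base => exact le_rfl
    | succ i _ ih =>
      rw [Finset.sum_range_succ]
      linarith [hdec i]

/-- The optimal tuple: gaps `Q`, with an extra `1` at every multiple of `m`. -/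
def balanced (Q m j : ℕ) : ℤ := ((Q * j + j / m : ℕ) : ℤ)

/-- Convexity estimate for a single pair of indices. -/
lemma zpow_pair_bound {x : ℝ} (hx : 2 ≤ x) {c e y : ℤ} (h : c = e ∨ c = e + 1) :
    (x - 1) * (x ^ (-e) * y) ≤ x * (x ^ (-c + y) - x ^ (-c)) := by
  have hx0 : (0 : ℝ) < x := by linarith
  rw [zpow_add₀ hx0.ne']
  rcases h with rfl | rfl
  · have h1 := mul_le_mul_of_nonneg_left (sub_one_mul_le_mul_zpow_sub_one hx y)
      (zpow_pos hx0 (-c)).le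
    linarith
  · have h1 := mul_le_mul_of_nonneg_left (sub_one_mul_le_zpow_sub_one hx y)
      (zpow_pos hx0 (-e)).le
    have h2 : x ^ (-e) = x * x ^ (-(e + 1)) := by
      rw [← zpow_one_add₀ hx0.ne']
      congr 1
      ring
    rw [h2] at h1 ⊢
    linarith

/-- Sharper estimate when the pair attains the smaller of the two possible differences. -/
lemma zpow_pair_bound_sharp {x : ℝ} (hx : 2 ≤ x) (e y : ℤ) :
    (x - 1) * (x ^ (-e) * y + (x - 1) * (x ^ (-e) * max (y : ℝ) 0)) ≤
      x * (x ^ (-e + y) - x ^ (-e)) := by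
  rcases le_total (y : ℝ) 0 with hy | hy
  · rw [max_eq_right hy]
    have := zpow_pair_bound hx (c := e) (y := y) (Or.inl rfl)
    linarith
  · have hx0 : (0 : ℝ) < x := by linarith
    rw [max_eq_left hy, zpow_add₀ hx0.ne']
    have h1 := mul_le_mul_of_nonneg_left (sub_one_mul_le_zpow_sub_one hx y)
      (zpow_pos hx0 (-e)).le
    have h2 := mul_le_mul_of_nonneg_left h1 hx0.le
    linarith

lemma balanced_sub {Q m k i : ℕ} (hm : 0 < m) (h : k ≤ i) :
    balanced Q m i - balanced Q m k = balanced Q m (i - k) ∨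
      balanced Q m i - balanced Q m k = balanced Q m (i - k) + 1 := by
  obtain ⟨l, rfl⟩ := Nat.exists_eq_add_of_le h
  simp only [balanced, Nat.add_sub_cancel_left, Nat.add_div hm]
  push_cast
  split_ifs
  · right; ring
  · left; ring

lemma balanced_sub_last {Q m g n k : ℕ} (hn : n + 1 = (g + 1) * m) (h : k ≤ n) :
    balanced Q m n - balanced Q m k = balanced Q m (n - k) := by
  obtain ⟨l, rfl⟩ := Nat.exists_eq_add_of_le h
  have hm : 0 < m := Nat.pos_of_ne_zero (by rintro rfl; simp at hn)
  have hlt : ¬ m ≤ k % m + l % m := by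
    intro hle
    have h1 := Nat.mod_lt k hm
    have h2 := Nat.mod_lt l hm
    have h3 : m ∣ k % m + l % m + 1 := by
      have : (k % m + l % m + 1) % m = (k + l + 1) % m := by simp [Nat.add_mod]
      exact Nat.dvd_of_mod_eq_zero
        (this.trans (Nat.mod_eq_zero_of_dvd ⟨g + 1, by rw [hn, mul_comm]⟩))
    obtain ⟨c, hc⟩ := h3
    have hc1 : 1 < c := by
      by_contra hcon
      have : m * c ≤ m * 1 := Nat.mul_le_mul_left m (by omega)
      omega
    have : m * 2 ≤ m * c := Nat.mul_le_mul_left m hc1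
    omega
  simp only [balanced, Nat.add_sub_cancel_left, Nat.add_div hm, if_neg hlt]
  push_cast
  ring

/-- The balanced tuple is the strict minimizer of `hp` among tuples with the same endpoints. -/
lemma hp_balanced_lt {p Q m g n : ℕ} (hp3 : 3 ≤ p) (hQ : 1 ≤ Q) (hn : n + 1 = (g + 1) * m)
    (a : ℕ → ℤ) (h0 : a 0 = balanced Q m 0) (hlast : a n = balanced Q m n)
    (hne : ∃ i ≤ n, a i ≠ balanced Q m i) :
    hp p (n + 1) (balanced Q m) < hp p (n + 1) a := by
  have hm : 0 < m := Nat.pos_of_ne_zero (by rintro rfl; simp at hn)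
  have hx : (3 : ℝ) ≤ p := by exact_mod_cast hp3
  set x : ℝ := (p : ℝ)
  have hx2 : (2 : ℝ) ≤ x := by linarith
  have hx0 : (0 : ℝ) < x := by linarith
  set b := balanced Q m with hb
  set W : ℕ → ℝ := fun k => x ^ (-b k) with hWdef
  set D : ℕ → ℝ := fun i => ((a i - b i : ℤ) : ℝ) with hD
  have hD0 : D 0 = 0 := by simp [hD, h0]
  have hDn : D n = 0 := by simp [hD, hlast]
  have hb0 : b 0 = 0 := by simp [hb, balanced]
  have hW : ∀ k, 0 < W k := fun k => zpow_pos hx0 _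
  have hdec : ∀ k, 2 * W (k + 1) ≤ W k := by
    intro k
    have h1 : b k + 1 ≤ b (k + 1) := by
      have := Nat.div_le_div_right (c := m) (Nat.le_succ k)
      simp only [hb, balanced]
      push_cast
      have h' : ((k / m : ℕ) : ℤ) ≤ ((k + 1) / m : ℕ) := by exact_mod_cast this
      push_cast at h'
      have hQ' : (1 : ℤ) ≤ Q := by exact_mod_cast hQ
      linarith
    have h2 : x ^ (-b (k + 1) + 1) ≤ x ^ (-b k) :=
      zpow_le_zpow_right₀ (by linarith) (by linarith)
    rw [zpow_add_one₀ hx0.ne'] at h2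
    have := hW (k + 1)
    simp only [hWdef] at this ⊢
    nlinarith
  set P : ℕ → ℝ := fun t => ∑ l ∈ Finset.range t, W (l + 1) with hP
  have pair : ∀ k ∈ Finset.range (n + 1), ∀ i ∈ Finset.range (n + 1),
      (x - 1) * ((if k < i then W (i - k) * (D k - D i) else 0) +
        (x - 1) * ((if k = 0 then W i * max (-D i) 0 else 0) +
          (if i = n then W (n - k) * max (D k) 0 else 0))) ≤
      x * ((if k < i then x ^ (a k - a i) else 0) -
        (if k < i then x ^ (b k - b i) else 0)) := by
    intro k hk i hi
    rw [Finset.mem_range] at hk hi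
    rcases Nat.lt_or_ge k i with hki | hki
    · simp only [if_pos hki]
      have hy : D k - D i = (((a k - b k) - (a i - b i) : ℤ) : ℝ) := by
        simp only [hD]; push_cast; ring
      have ha : a k - a i = -(b i - b k) + ((a k - b k) - (a i - b i)) := by ring
      have hbe : b k - b i = -(b i - b k) := by ring
      rw [ha, hbe]
      by_cases hk0 : k = 0
      · subst hk0
        have hs := zpow_pair_bound_sharp hx2 (b i) ((a 0 - b 0) - (a i - b i))
        rw [← hy, hD0, zero_sub] at hs
        rw [hb0, hD0] at *
        simpa [hWdef] using hs
      · by_cases hin : i = n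
        · subst hin
          have hs := zpow_pair_bound_sharp hx2 (b i - b k) ((a k - b k) - (a i - b i))
          rw [← hy, hDn, sub_zero] at hs
          rw [balanced_sub_last hn (by omega)] at hs ⊢
          simpa [hk0, hDn, hWdef] using hs
        · have hs := zpow_pair_bound hx2 (y := (a k - b k) - (a i - b i))
            (balanced_sub (Q := Q) hm hki.le)
          rw [← hy] at hs
          simpa [hk0, hin, hWdef] using hs
    · have e1 : (if k = 0 then W i * max (-D i) 0 else 0) = 0 := by
        split_ifs with hk0
        · have : i = 0 := by omega
          simp [this, hD0]
        · rfl
      have e2 : (if i = n then W (n - k) * max (D k) 0 else 0) = 0 := by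
        split_ifs with hin
        · have : k = n := by omega
          simp [this, hDn]
        · rfl
      rw [e1, e2]
      simp [Nat.not_lt.mpr hki]
  have total := Finset.sum_le_sum fun k hk => Finset.sum_le_sum (pair k hk)
  have hrhs : ∑ k ∈ Finset.range (n + 1), ∑ i ∈ Finset.range (n + 1),
      x * ((if k < i then x ^ (a k - a i) else 0) -
        (if k < i then x ^ (b k - b i) else 0)) = x * (hp p (n + 1) a - hp p (n + 1) b) := by
    simp only [hp, ← Finset.mul_sum, Finset.sum_sub_distrib]
    rfl
  have hlhs : ∑ k ∈ Finset.range (n + 1), ∑ i ∈ Finset.range (n + 1),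
      (x - 1) * ((if k < i then W (i - k) * (D k - D i) else 0) +
        (x - 1) * ((if k = 0 then W i * max (-D i) 0 else 0) +
          (if i = n then W (n - k) * max (D k) 0 else 0))) =
      (x - 1) * ∑ i ∈ Finset.range (n + 1), (D i * (P (n - i) - P i) +
        (x - 1) * (W i * max (-D i) 0 + W (n - i) * max (D i) 0)) := by
    simp only [← Finset.mul_sum, Finset.sum_add_distrib, sum_pairs_weighted_sub]
    congr 4
    · rw [Finset.sum_comm]
      refine Finset.sum_congr rfl fun i _ => ?_
      simp
    · refine Finset.sum_congr rfl fun i _ => ?_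
      simp
  have hpos : ∀ i, D i ≠ 0 → 0 < D i * (P (n - i) - P i) +
      (x - 1) * (W i * max (-D i) 0 + W (n - i) * max (D i) 0) := by
    intro i hi
    rcases lt_or_gt_of_ne hi with hlt | hgt
    · rw [max_eq_left (by linarith : 0 ≤ -D i), max_eq_right hlt.le]
      have h1 := partial_sum_le_add hW hdec (n - i) i
      have h2 : 0 < -D i * (P i - P (n - i) + (x - 1) * W i) := by
        refine mul_pos (by linarith) ?_
        simp only [hP]
        nlinarith [hW i]
      linarith
    · rw [max_eq_right (by linarith : -D i ≤ 0), max_eq_left hgt.le]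
      have h1 := partial_sum_le_add hW hdec i (n - i)
      have h2 : 0 < D i * (P (n - i) - P i + (x - 1) * W (n - i)) := by
        refine mul_pos hgt ?_
        simp only [hP]
        nlinarith [hW (n - i)]
      linarith
  obtain ⟨i₀, hi₀, hne₀⟩ := hne
  have hD₀ : D i₀ ≠ 0 := by
    simp only [hD]
    exact_mod_cast sub_ne_zero.mpr hne₀
  have hsum := Finset.sum_pos' (s := Finset.range (n + 1))
    (f := fun i => D i * (P (n - i) - P i) +
      (x - 1) * (W i * max (-D i) 0 + W (n - i) * max (D i) 0))
    (fun i _ => by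
      by_cases hi : D i = 0
      · simp [hi]
      · exact (hpos i hi).le)
    ⟨i₀, Finset.mem_range.mpr (by omega), hpos i₀ hD₀⟩
  rw [hrhs, hlhs] at total
  have := mul_pos (by linarith : 0 < x - 1) hsum
  have := pos_of_mul_pos_right (this.trans_le total) hx0.le
  linarith

/-- Theorem 2.2(iii): if `(r-1) ∤ (s-1)`, `(r-1) ∤ s`, `g ≡ s-1 mod (r-1)` is the least
positive residue, `2g ≤ r-2` and `(g+1) ∣ (r-g-1)` with `q₁ = (r-g-1)/(g+1)`, then the
delta vector of any minimizer is
`([q],…,[q] (q₁-fold), [q+1], [q],…,[q] (q₁-fold), [q+1], …, [q],…,[q] (q₁-fold))`,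
i.e. entry `j` (0-indexed) equals `[q]+1` iff `j ≡ q₁ mod (q₁+1)`, and `[q]` otherwise. -/
theorem stmt6 (p s r : ℕ) (hpp : p.Prime) (hp3 : 3 ≤ p) (hr : 3 ≤ r) (hrs : r < s)
    (hndvd1 : ¬ (r - 1) ∣ (s - 1)) (hndvd2 : ¬ (r - 1) ∣ s)
    (g : ℕ) (hgdef : g = (s - 1) % (r - 1))
    (hg : 2 * g ≤ r - 2) (hq1 : (g + 1) ∣ (r - g - 1))
    (q1 : ℕ) (hq1def : q1 = (r - g - 1) / (g + 1))
    (a : ℕ → ℤ) (ha : IsMinimizer p s r a) :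
    ∀ j < r - 1, dlt a j =
      if j % (q1 + 1) = q1
      then (((s - 1) / (r - 1) : ℕ) : ℤ) + 1
      else (((s - 1) / (r - 1) : ℕ) : ℤ) := by
  obtain ⟨n, rfl⟩ : ∃ n, r = n + 1 := ⟨r - 1, by omega⟩
  rw [Nat.add_sub_cancel] at *
  set Q := (s - 1) / n
  have hQ : 1 ≤ Q := (Nat.one_le_div_iff (by omega)).mpr (by omega)
  have hdm : n * Q + g = s - 1 := by rw [hgdef]; exact Nat.div_add_mod _ _
  have hn : n + 1 = (g + 1) * (q1 + 1) := by
    have := Nat.mul_div_cancel' hq1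
    rw [← hq1def] at this
    rw [mul_add, this]
    omega
  have hdiv : n / (q1 + 1) = g := by
    rw [add_mul, one_mul] at hn
    rw [Nat.div_eq_iff (Nat.succ_pos q1)]
    simp only [Nat.succ_eq_add_one]
    omega
  obtain ⟨⟨h0, hlast, -⟩, hmin⟩ := ha
  have hbn : balanced Q (q1 + 1) n = (s : ℤ) - 1 := by
    rw [balanced, hdiv, mul_comm Q n, hdm]
    omega
  have hadm : Admissible s (n + 1) (balanced Q (q1 + 1)) := by
    refine ⟨by simp [balanced], by simpa using hbn, fun i _ => ?_⟩
    have := Nat.div_le_div_right (c := q1 + 1) (Nat.le_succ i)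
    rw [Nat.succ_eq_add_one] at this
    simp only [balanced, Nat.cast_lt, mul_add]
    omega
  have heq : ∀ i ≤ n, a i = balanced Q (q1 + 1) i := by
    by_contra! hne
    exact absurd (hmin _ hadm) (not_le.mpr (hp_balanced_lt hp3 hQ hn a
      (by rw [h0]; simp [balanced]) (by rw [hbn]; exact hlast) hne))
  intro j hj
  rw [dlt, heq j (by omega), heq (j + 1) (by omega)]
  simp only [balanced, Nat.succ_div]
  have hiff : q1 + 1 ∣ j + 1 ↔ j % (q1 + 1) = q1 := by
    have h1 : j % (q1 + 1) < q1 + 1 := Nat.mod_lt j (Nat.succ_pos q1)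
    have h2 : j + 1 = (j % (q1 + 1) + 1) + (q1 + 1) * (j / (q1 + 1)) := by
      have := Nat.mod_add_div j (q1 + 1)
      omega
    rw [h2, Nat.dvd_add_left (dvd_mul_right _ _)]
    constructor
    · intro h
      have := Nat.le_of_dvd (Nat.succ_pos _) h
      omega
    · intro h
      rw [h]
  simp only [hiff]
  split_ifs <;> push_cast <;> ring
end

section
/- Let p ≥ 3 be a prime and let 3 ≤ r < s be integers with (r-1) ∤ (s-1), and let g be the least positive residue of s-1 modulo r-1. Suppose d ∈ Biv*(s,r) satisfies h_p(δ^{-1}(d)) = min h_p and 2g ≥ r-1. Then η_max(d) = 1 and θ(d) := θ_max(d) - θ_min(d) ≤ 1; that is, every maximal [q]-block of d is a singleton, and the lengths of any two maximal [q+1]-blocks of d differ by at most 1. -/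
/-- `δ⁻¹(d) = (0, d₁, d₁+d₂, …)`: the exponent tuple with delta vector `d`. -/
def deltaInv (d : ℕ → ℤ) (i : ℕ) : ℤ := ∑ j ∈ Finset.range i, d j

/-- The sum of the products of the entries of all nonempty prefixes of a list. -/
def prefixSum : List ℝ → ℝ
  | [] => 0
  | u :: l => u * (1 + prefixSum l)

/-- The sum of the products of the entries of all nonempty blocks of consecutive entries. -/
def blockSum : List ℝ → ℝ
  | [] => 0
  | u :: l => blockSum l + prefixSum (u :: l)

theorem prefixSum_append (l m : List ℝ) :
    prefixSum (l ++ m) = prefixSum l + l.prod * prefixSum m := by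
  induction l with
  | nil => simp [prefixSum]
  | cons u l ih => simp only [List.cons_append, prefixSum, ih, List.prod_cons]; ring

theorem blockSum_append (l m : List ℝ) :
    blockSum (l ++ m) = blockSum l + blockSum m + prefixSum l.reverse * prefixSum m := by
  induction l with
  | nil => simp [blockSum, prefixSum]
  | cons u l ih =>
    simp only [List.cons_append, blockSum, ih, List.reverse_cons, prefixSum, prefixSum_append,
      List.prod_reverse]
    ring

theorem blockSum_reverse (l : List ℝ) : blockSum l.reverse = blockSum l := by
  induction l with
  | nil => rfl
  | cons u l ih =>
    simp only [List.reverse_cons, blockSum_append, blockSum, prefixSum, ih, List.reverse_reverse]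
    ring

theorem blockSum_reverse_middle_sub (A U B : List ℝ) :
    blockSum (A ++ (U.reverse ++ B)) - blockSum (A ++ (U ++ B)) =
      (prefixSum A.reverse - prefixSum B) * (prefixSum U.reverse - prefixSum U) := by
  simp only [blockSum_append, prefixSum_append, blockSum_reverse, List.reverse_reverse,
    List.prod_reverse]
  ring

theorem prefixSum_nonneg {l : List ℝ} (h : ∀ u ∈ l, 0 ≤ u) : 0 ≤ prefixSum l := by
  induction l with
  | nil => simp [prefixSum]
  | cons u l ih =>
    have h1 := ih fun v hv => h v (List.mem_cons_of_mem _ hv)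
    have h2 := h u List.mem_cons_self
    simp only [prefixSum]
    positivity

theorem prefixSum_le_half {l : List ℝ} (h : ∀ u ∈ l, 0 ≤ u ∧ u ≤ 1 / 3) :
    prefixSum l ≤ 1 / 2 := by
  induction l with
  | nil => norm_num [prefixSum]
  | cons u l ih =>
    have h1 := ih fun v hv => h v (List.mem_cons_of_mem _ hv)
    have h2 := h u List.mem_cons_self
    simp only [prefixSum]
    nlinarith

theorem prefixSum_cons_lt_of_le_third {x z : ℝ} {l m : List ℝ} (hx : 0 < x) (hz : 0 ≤ z)
    (hzx : z ≤ x / 3) (hl : ∀ u ∈ l, 0 ≤ u) (hm : ∀ u ∈ m, 0 ≤ u ∧ u ≤ 1 / 3) :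
    prefixSum (z :: m) < prefixSum (x :: l) := by
  have h1 := prefixSum_nonneg hl
  have h2 := prefixSum_le_half hm
  simp only [prefixSum]
  nlinarith

/-- Reversing the middle block `x, …, z` of a list of the form
`…, x, z, …, z, (x, …, z), z, …, z, z, …` decreases the block sum. -/
theorem blockSum_reverse_middle_lt {x z : ℝ} (c : ℕ) (A T B : List ℝ) (hx : 0 < x)
    (hz : 0 < z) (hzx : z ≤ x / 3) (hx3 : x ≤ 1 / 3)
    (hA : ∀ u ∈ A, 0 ≤ u ∧ u ≤ 1 / 3) (hT : ∀ u ∈ T, 0 ≤ u ∧ u ≤ 1 / 3)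
    (hB : ∀ u ∈ B, 0 ≤ u ∧ u ≤ 1 / 3) :
    blockSum ((A ++ x :: List.replicate c z) ++ ((x :: (T ++ [z])).reverse ++
        (List.replicate c z ++ z :: B))) <
      blockSum ((A ++ x :: List.replicate c z) ++ ((x :: (T ++ [z])) ++
        (List.replicate c z ++ z :: B))) := by
  rw [← sub_neg, blockSum_reverse_middle_sub]
  refine mul_neg_of_pos_of_neg ?_ ?_
  · have h := prefixSum_cons_lt_of_le_third (l := A.reverse) (m := B) hx hz.le hzx
      (fun u hu => (hA u (List.mem_reverse.1 hu)).1) hB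
    have hc : 0 < z ^ c := pow_pos hz c
    simp only [List.reverse_append, List.reverse_cons, List.reverse_replicate, List.append_assoc,
      List.singleton_append, prefixSum_append, List.prod_replicate]
    nlinarith
  · have h := prefixSum_cons_lt_of_le_third (l := T ++ [z]) (m := T.reverse ++ [x]) hx hz.le hzx
      (by
        intro u hu
        rcases List.mem_append.1 hu with hu | hu
        · exact (hT u hu).1
        · rw [List.mem_singleton.1 hu]; exact hz.le)
      (by
        intro u hu
        rcases List.mem_append.1 hu with hu | hu
        · exact hT u (List.mem_reverse.1 hu)
        · rw [List.mem_singleton.1 hu]; exact ⟨hx.le, hx3⟩)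
    simpa [sub_neg] using h

theorem hp_succ (p m : ℕ) (a : ℕ → ℤ) :
    hp p (m + 1) a = hp p m a + ∑ k ∈ Finset.range m, (p : ℝ) ^ (a k - a m) := by
  unfold hp
  rw [Finset.sum_range_succ]
  have h1 : ∑ i ∈ Finset.range (m + 1), (if m < i then (p : ℝ) ^ (a m - a i) else 0) = 0 :=
    Finset.sum_eq_zero fun i hi => if_neg (by have := Finset.mem_range.1 hi; omega)
  rw [h1, add_zero, ← Finset.sum_add_distrib]
  refine Finset.sum_congr rfl fun k hk => ?_
  rw [Finset.sum_range_succ, if_pos (Finset.mem_range.1 hk)]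

theorem sum_zpow_deltaInv_sub {p : ℕ} (hp0 : p ≠ 0) (b : ℕ → ℤ) (n : ℕ) :
    ∑ k ∈ Finset.range n, (p : ℝ) ^ (deltaInv b k - deltaInv b n) =
      prefixSum ((List.range n).map fun j => (p : ℝ) ^ (-b j)).reverse := by
  have hp' : (p : ℝ) ≠ 0 := Nat.cast_ne_zero.2 hp0
  induction n with
  | zero => simp [prefixSum]
  | succ n ih =>
    have h : deltaInv b (n + 1) = deltaInv b n + b n := Finset.sum_range_succ ..
    rw [List.range_succ, List.map_append, List.reverse_append]
    simp only [List.map_cons, List.map_nil, List.reverse_singleton, List.singleton_append,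
      prefixSum]
    rw [← ih, Finset.sum_range_succ, h, mul_add, Finset.mul_sum, add_comm]
    congr 1
    · simp
    · refine Finset.sum_congr rfl fun k _ => ?_
      rw [← zpow_add₀ hp']
      congr 1
      ring

theorem hp_deltaInv {p : ℕ} (hp0 : p ≠ 0) (b : ℕ → ℤ) (n : ℕ) :
    hp p (n + 1) (deltaInv b) = blockSum ((List.range n).map fun j => (p : ℝ) ^ (-b j)) := by
  induction n with
  | zero => simp [hp, blockSum]
  | succ n ih =>
    rw [hp_succ, ih, sum_zpow_deltaInv_sub hp0, List.range_succ, List.map_append, blockSum_append,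
      List.reverse_append]
    simp [blockSum, prefixSum]
    ring

theorem map_range_getD (l : List ℤ) : (List.range l.length).map (fun j => l.getD j 0) = l := by
  refine List.ext_getElem (by simp) fun i h1 h2 => ?_
  simp [h2]

/-- A delta vector `d` with minimal `h_p` also minimises the block sum among its own
rearrangements. -/
theorem blockSum_le_of_perm {p s n : ℕ} (hp0 : p ≠ 0) {d : ℕ → ℤ} (hpos : ∀ j < n, 0 < d j)
    (hsum : ∑ j ∈ Finset.range n, d j = (s : ℤ) - 1)
    (hmin : ∀ b : ℕ → ℤ, Admissible s (n + 1) b → hp p (n + 1) (deltaInv d) ≤ hp p (n + 1) b)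
    {l : List ℤ} (hl : l.Perm ((List.range n).map d)) :
    blockSum (((List.range n).map d).map fun k => (p : ℝ) ^ (-k)) ≤
      blockSum (l.map fun k => (p : ℝ) ^ (-k)) := by
  have hlen : l.length = n := by simpa using hl.length_eq
  have hadm : Admissible s (n + 1) (deltaInv fun j => l.getD j 0) := by
    refine ⟨rfl, ?_, fun i hi => ?_⟩
    · have h1 : ∀ f : ℕ → ℤ, ∑ j ∈ Finset.range n, f j = ((List.range n).map f).sum := by
        intro f
        simp [Finset.sum, Finset.range, Multiset.range]
      rw [Nat.add_sub_cancel, deltaInv, h1, ← hsum, h1, ← hl.sum_eq]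
      conv_rhs => rw [← map_range_getD l, hlen]
    · have h2 : deltaInv (fun j => l.getD j 0) (i + 1) =
          deltaInv (fun j => l.getD j 0) i + l.getD i 0 := Finset.sum_range_succ ..
      have hil : i < l.length := by omega
      have h3 : l.getD i 0 ∈ (List.range n).map d := by
        rw [List.getD_eq_getElem _ _ hil]
        exact hl.subset (List.getElem_mem hil)
      obtain ⟨j, hj, hj'⟩ := List.mem_map.1 h3
      have := hpos j (List.mem_range.1 hj)
      omega
  have h := hmin _ hadm
  rw [hp_deltaInv hp0, hp_deltaInv hp0] at h
  have h4 : l.map (fun k => (p : ℝ) ^ (-k)) =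
      (List.range n).map fun j => (p : ℝ) ^ (-l.getD j 0) := by
    conv_lhs => rw [← map_range_getD l, hlen]
    rw [List.map_map]
    rfl
  rw [h4, List.map_map]
  exact h

/-- If a list with entries `f` and `f + 1` has minimal block sum among its rearrangements, then
no block `f, (f + 1)^c, f` is followed by a block `(f + 1)^(c + 2)`. -/
theorem not_forbidden_of_minimal {p : ℕ} (hp3 : 3 ≤ p) {f : ℤ} (hf : 1 ≤ f) (c : ℕ)
    (A T B : List ℤ)
    (hmem : ∀ k ∈ A ++ T ++ B, k = f ∨ k = f + 1)
    (hmin : ∀ l : List ℤ, l.Perm ((A ++ f :: List.replicate c (f + 1)) ++ ((f :: (T ++ [f + 1])) ++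
        (List.replicate c (f + 1) ++ (f + 1) :: B))) →
      blockSum (((A ++ f :: List.replicate c (f + 1)) ++ ((f :: (T ++ [f + 1])) ++
        (List.replicate c (f + 1) ++ (f + 1) :: B))).map fun k => (p : ℝ) ^ (-k)) ≤
      blockSum (l.map fun k => (p : ℝ) ^ (-k))) : False := by
  have hp3' : (3 : ℝ) ≤ p := by exact_mod_cast hp3
  have hp0 : (0 : ℝ) < p := by linarith
  have hz : (p : ℝ) ^ (-(f + 1)) ≤ (p : ℝ) ^ (-f) / 3 := by
    rw [show -(f + 1) = -f - 1 by ring, zpow_sub_one₀ hp0.ne', ← div_eq_mul_inv]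
    exact div_le_div_of_nonneg_left (zpow_pos hp0 _).le (by norm_num) hp3'
  have hx : (p : ℝ) ^ (-f) ≤ 1 / 3 := by
    calc (p : ℝ) ^ (-f) ≤ (p : ℝ) ^ (-1 : ℤ) := zpow_le_zpow_right₀ (by linarith) (by omega)
      _ ≤ 1 / 3 := by
        rw [zpow_neg_one, ← one_div]
        exact div_le_div_of_nonneg_left zero_le_one (by norm_num) hp3'
  have hw : ∀ k, k = f ∨ k = f + 1 → 0 ≤ (p : ℝ) ^ (-k) ∧ (p : ℝ) ^ (-k) ≤ 1 / 3 := by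
    rintro k (rfl | rfl)
    · exact ⟨(zpow_pos hp0 _).le, hx⟩
    · exact ⟨(zpow_pos hp0 _).le, by have := zpow_pos hp0 (-f); linarith⟩
  have hw' : ∀ l : List ℤ, l ⊆ A ++ T ++ B →
      ∀ u ∈ l.map (fun k => (p : ℝ) ^ (-k)), 0 ≤ u ∧ u ≤ 1 / 3 := by
    intro l hl u hu
    obtain ⟨k, hk, rfl⟩ := List.mem_map.1 hu
    exact hw k (hmem k (hl hk))
  have h1 := hmin ((A ++ f :: List.replicate c (f + 1)) ++ ((f :: (T ++ [f + 1])).reverse ++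
    (List.replicate c (f + 1) ++ (f + 1) :: B)))
    (((List.reverse_perm _).append_right _).append_left _)
  have h2 := blockSum_reverse_middle_lt c (A.map fun k => (p : ℝ) ^ (-k))
    (T.map fun k => (p : ℝ) ^ (-k)) (B.map fun k => (p : ℝ) ^ (-k)) (zpow_pos hp0 (-f))
    (zpow_pos hp0 (-(f + 1))) hz hx (hw' A (by simp)) (hw' T (by simp)) (hw' B (by simp))
  simp only [List.map_append, List.map_cons, List.map_nil, List.map_replicate,
    List.map_reverse] at h1
  exact absurd h1 (not_le.2 (by simpa using h2))

/-- The list of the values `d i, …, d (j - 1)`. -/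
def slice (d : ℕ → ℤ) (i j : ℕ) : List ℤ := (List.range' i (j - i)).map d

theorem slice_append (d : ℕ → ℤ) {i j k : ℕ} (hij : i ≤ j) (hjk : j ≤ k) :
    slice d i k = slice d i j ++ slice d j k := by
  rw [slice, slice, slice, ← List.map_append]
  congr 1
  have h := List.range'_append (s := i) (m := j - i) (n := k - j) (step := 1)
  rw [show i + 1 * (j - i) = j by omega, show j - i + (k - j) = k - i by omega] at h
  exact h.symm

theorem slice_eq_cons (d : ℕ → ℤ) {i k : ℕ} (hik : i < k) :
    slice d i k = d i :: slice d (i + 1) k := by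
  rw [slice_append d (Nat.le_succ i) hik]
  simp [slice]

theorem slice_eq_concat (d : ℕ → ℤ) {i k : ℕ} (hik : i ≤ k) :
    slice d i (k + 1) = slice d i k ++ [d k] := by
  rw [slice_append d hik (Nat.le_succ k)]
  simp [slice]

theorem slice_eq_replicate {d : ℕ → ℤ} {i c : ℕ} {v : ℤ} (h : ∀ k < c, d (i + k) = v) :
    slice d i (i + c) = List.replicate c v := by
  rw [List.eq_replicate_iff]
  refine ⟨by simp [slice], fun b hb => ?_⟩
  obtain ⟨j, hj, rfl⟩ := List.mem_map.1 hb
  rw [List.mem_range'_1] at hj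
  have := h (j - i) (by omega)
  rwa [Nat.add_sub_cancel' hj.1] at this

theorem mem_slice {d : ℕ → ℤ} {i j : ℕ} {v : ℤ} (h : v ∈ slice d i j) :
    ∃ k < j, d k = v := by
  obtain ⟨k, hk, rfl⟩ := List.mem_map.1 h
  rw [List.mem_range'_1] at hk
  exact ⟨k, by omega, rfl⟩

theorem false_of_short_before_long {p n : ℕ} (hp3 : 3 ≤ p) {f : ℤ} (hf : 1 ≤ f) {d : ℕ → ℤ}
    (hmem : ∀ j < n, d j = f ∨ d j = f + 1)
    (hmin : ∀ l : List ℤ, l.Perm ((List.range n).map d) →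
      blockSum (((List.range n).map d).map fun k => (p : ℝ) ^ (-k)) ≤
        blockSum (l.map fun k => (p : ℝ) ^ (-k)))
    {i c m : ℕ} (hi : d i = f) (hic : ∀ k < c, d (i + 1 + k) = f + 1) (hi' : d (i + 1 + c) = f)
    (him : i + 1 + c < m) (hm : ∀ k < c + 2, d (m + k) = f + 1) (hmn : m + c + 1 < n) :
    False := by
  have hm0 : d m = f + 1 := hm 0 (by omega)
  have hmc : d (m + 1 + c) = f + 1 := by
    have := hm (c + 1) (by omega)
    rwa [show m + (c + 1) = m + 1 + c by omega] at this
  have hrun : ∀ k < c, d (m + 1 + k) = f + 1 := fun k hk => by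
    have := hm (k + 1) (by omega)
    rwa [show m + (k + 1) = m + 1 + k by omega] at this
  have hD : (List.range n).map d =
      (slice d 0 i ++ f :: List.replicate c (f + 1)) ++
        ((f :: (slice d (i + 1 + c + 1) m ++ [f + 1])) ++
        (List.replicate c (f + 1) ++ (f + 1) :: slice d (m + 1 + c + 1) n)) := by
    have h0 : (List.range n).map d = slice d 0 n := by rw [slice, List.range_eq_range']; simp
    rw [h0, slice_append d (Nat.zero_le (i + 1 + c)) (by omega : i + 1 + c ≤ n),
      slice_append d (Nat.zero_le i) (by omega : i ≤ i + 1 + c),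
      slice_eq_cons d (by omega : i < i + 1 + c), slice_eq_replicate hic,
      slice_append d (by omega : i + 1 + c ≤ m + 1) (by omega : m + 1 ≤ n),
      slice_eq_cons d (by omega : i + 1 + c < m + 1), slice_eq_concat d (by omega),
      slice_append d (by omega : m + 1 ≤ m + 1 + c) (by omega : m + 1 + c ≤ n),
      slice_eq_replicate hrun, slice_eq_cons d (by omega : m + 1 + c < n), hi, hi', hm0, hmc]
  rw [hD] at hmin
  refine not_forbidden_of_minimal hp3 hf c _ _ _ ?_ hmin
  intro v hv
  simp only [List.mem_append] at hv
  obtain ⟨k, hk, rfl⟩ : ∃ k < n, d k = v := by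
    rcases hv with (hv | hv) | hv <;> obtain ⟨k, hk, rfl⟩ := mem_slice hv <;>
      exact ⟨k, by omega, rfl⟩
  exact hmem k hk

theorem false_of_long_before_short {p n : ℕ} (hp3 : 3 ≤ p) {f : ℤ} (hf : 1 ≤ f) {d : ℕ → ℤ}
    (hmem : ∀ j < n, d j = f ∨ d j = f + 1)
    (hmin : ∀ l : List ℤ, l.Perm ((List.range n).map d) →
      blockSum (((List.range n).map d).map fun k => (p : ℝ) ^ (-k)) ≤
        blockSum (l.map fun k => (p : ℝ) ^ (-k)))
    {i c m : ℕ} (hi : d i = f) (hic : ∀ k < c, d (i + 1 + k) = f + 1) (hi' : d (i + 1 + c) = f)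
    (hin : i + 1 + c < n) (hm : ∀ k < c + 2, d (m + k) = f + 1) (hmi : m + c + 1 < i) :
    False := by
  have hrev : (List.range n).map (fun j => d (n - 1 - j)) = ((List.range n).map d).reverse := by
    refine List.ext_getElem (by simp) fun k h1 h2 => ?_
    simp
  refine false_of_short_before_long (n := n) (d := fun j => d (n - 1 - j)) hp3 hf
    (fun j hj => hmem _ (by omega)) ?_ (i := n - 1 - (i + 1 + c)) (c := c)
    (m := n - 1 - (m + c + 1)) ?_ ?_ ?_ (by omega) ?_ (by omega)
  · intro l hl
    rw [hrev] at hl ⊢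
    rw [List.map_reverse, blockSum_reverse]
    exact hmin l (hl.trans (List.reverse_perm _))
  · rw [← hi']
    congr 1
    omega
  · intro k hk
    rw [← hic (c - 1 - k) (by omega)]
    congr 1
    omega
  · rw [← hi]
    congr 1
    omega
  · intro k hk
    rw [← hm (c + 1 - k) (by omega)]
    congr 1
    omega

/-- A vector with entries `f`, `f + 1`, with end entries `f`, in which at least half of the
entries are `f + 1`, has two consecutive entries `f + 1`. -/
theorem exists_two_consecutive {n g : ℕ} {f : ℤ} {d : ℕ → ℤ} (hn : 1 ≤ n)
    (hmem : ∀ j < n, d j = f ∨ d j = f + 1)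
    (hsum : ∑ j ∈ Finset.range n, d j = n * f + g) (h0 : d 0 = f) (hn1 : d (n - 1) = f)
    (hg : n ≤ 2 * g) : ∃ m, m + 1 < n ∧ d m = f + 1 ∧ d (m + 1) = f + 1 := by
  by_contra! hno
  obtain ⟨n, rfl⟩ : ∃ k, n = k + 1 := ⟨n - 1, by omega⟩
  have h1 : ∑ j ∈ Finset.range n, (d j + d (j + 1)) ≤ ∑ _j ∈ Finset.range n, (2 * f + 1) := by
    refine Finset.sum_le_sum fun j hj => ?_
    have hj := Finset.mem_range.1 hj
    have h2 := hmem j (by omega)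
    have h3 := hmem (j + 1) (by omega)
    have h4 := hno j (by omega)
    omega
  rw [Finset.sum_add_distrib, Finset.sum_const, Finset.card_range, nsmul_eq_mul] at h1
  have h2 := hsum
  rw [Finset.sum_range_succ] at hsum
  rw [Finset.sum_range_succ'] at h2
  rw [Nat.add_sub_cancel] at hn1
  push_cast at hsum h2
  have hg' : (n : ℤ) + 1 ≤ 2 * g := by exact_mod_cast hg
  nlinarith

/-- Proposition 5.2(i): if `(r-1) ∤ (s-1)`, `g ≡ s-1 mod (r-1)` is the least positive
residue, `d ∈ Biv*(s,r)` (entries in `{[q], [q]+1}`, summing to `s-1`, first and last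
entries `[q]`) with `h_p(δ⁻¹(d)) = min h_p`, and `2g ≥ r-1`, then `η_max(d) = 1` (every
maximal `[q]`-block of `d` is a singleton) and `θ(d) = θ_max(d) - θ_min(d) ≤ 1` (the
lengths of any two maximal `[q]+1`-blocks differ by at most 1). -/
theorem stmt13 (p s r : ℕ) (hpp : p.Prime) (hp3 : 3 ≤ p) (hr : 3 ≤ r) (hrs : r < s)
    (hndvd1 : ¬ (r - 1) ∣ (s - 1))
    (g : ℕ) (hgdef : g = (s - 1) % (r - 1)) (hg : r - 1 ≤ 2 * g)
    (fq : ℤ) (hfq : fq = (((s - 1) / (r - 1) : ℕ) : ℤ))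
    (d : ℕ → ℤ)
    (hmem : ∀ j < r - 1, d j = fq ∨ d j = fq + 1)
    (hsum : ∑ j ∈ Finset.range (r - 1), d j = (s : ℤ) - 1)
    (hframe : d 0 = fq ∧ d (r - 2) = fq)
    (hmin : ∀ b : ℕ → ℤ, Admissible s r b → hp p r (deltaInv d) ≤ hp p r b) :
    (∀ i l, IsMaxRun (r - 1) d fq i l → l = 1) ∧
    (∀ i l i' l', IsMaxRun (r - 1) d (fq + 1) i l → IsMaxRun (r - 1) d (fq + 1) i' l' →
      l ≤ l' + 1) := by
  obtain ⟨n, rfl⟩ : ∃ n, r = n + 1 := ⟨r - 1, by omega⟩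
  simp only [Nat.add_sub_cancel] at *
  rw [show n + 1 - 2 = n - 1 by omega] at hframe
  obtain ⟨hd0, hdn⟩ := hframe
  have hf : 1 ≤ fq := by
    have : 1 ≤ (s - 1) / n := (Nat.one_le_div_iff (by omega)).2 (by omega)
    rw [hfq]
    exact_mod_cast this
  have hdiv : (s : ℤ) - 1 = n * fq + g := by
    have h := Nat.div_add_mod (s - 1) n
    rw [← hgdef] at h
    rw [hfq]
    have h' : (s : ℤ) - 1 = ((s - 1 : ℕ) : ℤ) := by omega
    rw [h']
    exact_mod_cast h.symm
  have hperm : ∀ l : List ℤ, l.Perm ((List.range n).map d) →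
      blockSum (((List.range n).map d).map fun k => (p : ℝ) ^ (-k)) ≤
        blockSum (l.map fun k => (p : ℝ) ^ (-k)) := fun l hl =>
    blockSum_le_of_perm hpp.ne_zero
      (fun j hj => by rcases hmem j hj with h | h <;> omega) hsum hmin hl
  refine ⟨fun i l hrun => ?_, fun i l i' l' hrun hrun' => ?_⟩
  · obtain ⟨hl, hil, hv, -, -⟩ := hrun
    by_contra hl1
    obtain ⟨m, hmn, hm, hm'⟩ := exists_two_consecutive (by omega) hmem (hsum.trans hdiv) hd0 hdn hg
    have hi0 : d i = fq := hv 0 hl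
    have hi1 : d (i + 1) = fq := hv 1 (by omega)
    have hm2 : ∀ k < 0 + 2, d (m + k) = fq + 1 := by
      intro k hk
      interval_cases k
      exacts [hm, hm']
    have hne : ∀ a b, d a = fq → d b = fq + 1 → a ≠ b := by
      rintro a b ha hb rfl
      omega
    have h1 := hne _ _ hi0 hm
    have h2 := hne _ _ hi0 hm'
    have h3 := hne _ _ hi1 hm
    rcases lt_or_ge i m with h | h
    · exact false_of_short_before_long hp3 hf hmem hperm (c := 0) hi0 (by simp) hi1 (by omega) hm2
        (by omega)
    · exact false_of_long_before_short hp3 hf hmem hperm (c := 0) hi0 (by simp) hi1 (by omega) hm2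
        (by omega)
  · obtain ⟨-, hil, hv, -, -⟩ := hrun
    obtain ⟨hl', hil', hv', hleft, hright⟩ := hrun'
    by_contra! hlt
    have hne : ∀ a b, d a = fq → d b = fq + 1 → a ≠ b := by
      rintro a b ha hb rfl
      omega
    have hi'0 : 0 < i' := Nat.pos_of_ne_zero (hne 0 i' hd0 (hv' 0 hl')).symm
    have hend : i' + l' < n := by
      have := hne _ _ hdn (hv' (l' - 1) (by omega))
      omega
    have hL : d (i' - 1) = fq := (hmem _ (by omega)).resolve_right (hleft hi'0)
    have hR : d (i' + l') = fq := (hmem _ hend).resolve_right (hright hend)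
    have outside : ∀ a, d a = fq → a < i ∨ i + l ≤ a := by
      intro a ha
      by_contra! hcon
      have := hne _ _ ha (hv (a - i) (by omega))
      omega
    have hm2 : ∀ k < l' + 2, d (i + k) = fq + 1 := fun k hk => hv k (by omega)
    have hs : i' - 1 + 1 = i' := by omega
    rcases outside _ hL with h | h
    · have := outside _ hR
      exact false_of_short_before_long hp3 hf hmem hperm (c := l') hL (by rwa [hs]) (by rwa [hs])
        (by omega) hm2 (by omega)
    · exact false_of_long_before_short hp3 hf hmem hperm (c := l') hL (by rwa [hs]) (by rwa [hs])
        (by omega) hm2 (by omega)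
end
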